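/- arXiv:1808.07137 — 2 statements merged into one kernel-verified Lean document; each statement's English description precedes it below -/
import Mathlib

section
/- There is a constant C depending only on n such that for every measurable u : ℝ^{n+1}_+ → ℂ and every cube Q ⊂ ℝⁿ: ∫_Q ∫_{ℓ(Q)/4}^{∞} ∫_{|x−y|<t} |u(y,t)|² t^{1−n} dy dt dx ≤ C |Q| ( ⨍_{2Q} A₂⁺(t u)(z) dz )², where A₂⁺(t u)(z) = ( ∫_0^∞ ∫_{|z−y|<t} |u(y,t)|² t^{1−n} dy dt )^{1/2}. -/
/- STATEMENT 2: The "away-from-the-boundary" part of the area integral over a cube is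
bounded by the averaged area integral over the doubled cube. -/

open MeasureTheory ENNReal Set Finset
noncomputable section

/-- The open axis-parallel cube in `ℝⁿ` with center `c` and side length `ℓ`. -/
def cube {n : ℕ} (c : Fin n → ℝ) (ℓ : ℝ) : Set (Fin n → ℝ) :=
  {x | ∀ i, |x i - c i| < ℓ / 2}

/-- Euclidean distance on `ℝⁿ` (modeled as `Fin n → ℝ`). -/
def eudist {n : ℕ} (x y : Fin n → ℝ) : ℝ :=
  Real.sqrt (∑ i, (x i - y i) ^ 2)

/-- The Lusin area integral `A₂⁺(tu)` applied to the squared-magnitude density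
`G = ‖u‖²`:  `lusin G x = ( ∫_0^∞ ∫_{|x−y|<t} G(y,t) t^{1−n} dy dt )^{1/2}`. -/
def lusin {n : ℕ} (G : (Fin n → ℝ) × ℝ → ℝ≥0∞) (x : Fin n → ℝ) : ℝ≥0∞ :=
  (∫⁻ p in {p : (Fin n → ℝ) × ℝ | 0 < p.2 ∧ eudist x p.1 < p.2},
      G p * ENNReal.ofReal (p.2 ^ ((1 : ℝ) - n))) ^ (1/2 : ℝ)

lemma eudist_eq_dist_toLp {n : ℕ} (x y : Fin n → ℝ) :
    eudist x y = dist (WithLp.toLp 2 x) (WithLp.toLp 2 y) := by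
  simp [eudist, EuclideanSpace.dist_eq, Real.dist_eq, sq_abs]

lemma eudist_triangle {n : ℕ} (x y z : Fin n → ℝ) :
    eudist x z ≤ eudist x y + eudist y z := by
  simpa only [eudist_eq_dist_toLp] using dist_triangle _ _ _

lemma exists_eudist_le_le {n : ℕ} {x z : Fin n → ℝ} {δ ε : ℝ} (hδ : 0 ≤ δ) (hε : 0 ≤ ε)
    (h : eudist x z ≤ ε + δ) : ∃ y, eudist x y ≤ δ ∧ eudist y z ≤ ε := by
  simp only [eudist_eq_dist_toLp] at h ⊢
  obtain ⟨y, hxy, hyz⟩ := exists_dist_le_le hδ hε h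
  exact ⟨WithLp.ofLp y, hxy, hyz⟩

lemma abs_sub_le_eudist {n : ℕ} (x y : Fin n → ℝ) (i : Fin n) : |x i - y i| ≤ eudist x y :=
  Real.abs_le_sqrt
    (Finset.single_le_sum (f := fun i => (x i - y i) ^ 2) (fun _ _ => sq_nonneg _) (mem_univ i))

lemma eudist_lt_of_forall_abs_sub_lt {n : ℕ} {x y : Fin n → ℝ} {r : ℝ} (hr : 0 < r)
    (h : ∀ i, |x i - y i| < r) : eudist x y < (n + 1) * r := by
  have hsum : ∑ i, (x i - y i) ^ 2 ≤ n * r ^ 2 := by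
    have := Finset.sum_le_card_nsmul Finset.univ (fun i => (x i - y i) ^ 2) (r ^ 2)
      fun i _ => sq_le_sq.2 (by rw [abs_of_pos hr]; exact (h i).le)
    simpa using this
  rw [eudist, Real.sqrt_lt' (by positivity)]
  have hn : (0 : ℝ) ≤ n := n.cast_nonneg
  nlinarith [pow_pos hr 2, mul_nonneg hn (sq_nonneg r),
    mul_nonneg (sq_nonneg (n : ℝ)) (sq_nonneg r)]

lemma cube_eq_pi {n : ℕ} (c : Fin n → ℝ) (ℓ : ℝ) :
    cube c ℓ = Set.univ.pi fun i => Set.Ioo (c i - ℓ / 2) (c i + ℓ / 2) := by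
  ext x
  simp only [cube, Set.mem_ofPred_eq, Set.mem_univ_pi, Set.mem_Ioo, abs_lt]
  refine forall_congr' fun i => ?_
  constructor <;> rintro ⟨h₁, h₂⟩ <;> constructor <;> linarith

lemma measurableSet_cube {n : ℕ} (c : Fin n → ℝ) (ℓ : ℝ) : MeasurableSet (cube c ℓ) := by
  rw [cube_eq_pi]
  exact MeasurableSet.univ_pi fun _ => measurableSet_Ioo

lemma volume_cube {n : ℕ} (c : Fin n → ℝ) (ℓ : ℝ) :
    volume (cube c ℓ) = ENNReal.ofReal ℓ ^ n := by
  rw [cube_eq_pi, Real.volume_pi_Ioo]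
  simp

/-- If the integral of the area density over `S` is controlled by every cone with vertex in the
cube `R`, it is controlled by the mean of `lusin` over any cube containing `R`. -/
lemma setLIntegral_le_average_lusin {n : ℕ} (G : (Fin n → ℝ) × ℝ → ℝ≥0∞)
    {S : Set ((Fin n → ℝ) × ℝ)} {R P : Set (Fin n → ℝ)} {K : ℝ≥0∞} (hR : MeasurableSet R)
    (hRP : R ⊆ P) (hR₀ : volume R ≠ 0) (hP : volume P ≠ ⊤) (hK : volume P = K * volume R)
    (hS : ∀ p ∈ S, 0 < p.2 ∧ ∀ z ∈ R, eudist z p.1 < p.2) :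
    ∫⁻ p in S, G p * ENNReal.ofReal (p.2 ^ ((1 : ℝ) - n)) ≤
      K ^ 2 * ((∫⁻ z in P, lusin G z) / volume P) ^ 2 := by
  set I := ∫⁻ p in S, G p * ENNReal.ofReal (p.2 ^ ((1 : ℝ) - n))
  have hP₀ : volume P ≠ 0 := fun h => hR₀ (measure_mono_null hRP h)
  have hlow : I ^ (1 / 2 : ℝ) * volume R ≤ ∫⁻ z in P, lusin G z :=
    calc I ^ (1 / 2 : ℝ) * volume R = ∫⁻ _ in R, I ^ (1 / 2 : ℝ) := by
          rw [setLIntegral_const]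
      _ ≤ ∫⁻ z in R, lusin G z := by
          refine setLIntegral_mono' hR fun z hz => ?_
          exact ENNReal.rpow_le_rpow
            (lintegral_mono_set fun p hp => ⟨(hS p hp).1, (hS p hp).2 z hz⟩) (by norm_num)
      _ ≤ _ := lintegral_mono_set hRP
  have hroot : I ^ (1 / 2 : ℝ) ≤ K * ((∫⁻ z in P, lusin G z) / volume P) := by
    rw [← mul_div_assoc, ENNReal.le_div_iff_mul_le (.inl hP₀) (.inl hP), hK, mul_left_comm]
    gcongr
  calc I = (I ^ (1 / 2 : ℝ)) ^ 2 := by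
        rw [← ENNReal.rpow_natCast, ← ENNReal.rpow_mul]
        norm_num
    _ ≤ _ := by
        rw [← mul_pow]
        gcongr

/-- A cone of height at least `ℓ / 4` meeting the cube of side `ℓ` contains, within the doubled
cube, a whole small cube whose center is taken from a given net. -/
lemma exists_cube_subset_cone {n : ℕ} {T : Set (Fin n → ℝ)} {h : ℝ} (hh : 16 * (n + 1) * h = 1)
    (hT : Metric.closedBall (0 : Fin n → ℝ) 1 ⊆ ⋃ g ∈ T, Metric.ball g h)
    {c x y : Fin n → ℝ} {ℓ t : ℝ} (hℓ : 0 < ℓ) (hx : x ∈ cube c ℓ) (ht : ℓ / 4 < t)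
    (hxy : eudist x y < t) :
    ∃ g ∈ T, cube (c + ℓ • g) (2 * h * ℓ) ⊆ cube c (2 * ℓ) ∧
      ∀ z ∈ cube (c + ℓ • g) (2 * h * ℓ), eudist z y < t := by
  have hn : (0 : ℝ) ≤ n := n.cast_nonneg
  have hh₀ : 0 < h := by
    by_contra! hneg
    nlinarith [mul_nonneg hn (neg_nonneg.2 hneg)]
  have hh₁ : h ≤ 1 / 16 := by nlinarith [mul_nonneg hn hh₀.le]
  obtain ⟨w, hxw, hwy⟩ := exists_eudist_le_le (x := x) (z := y) (δ := ℓ / 8) (ε := t - ℓ / 8)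
    (by positivity) (by linarith) (by linarith)
  have hwc : ∀ i, |w i - c i| ≤ ℓ * (5 / 8) := fun i => by
    have h₁ := abs_sub_le_eudist x w i
    have h₂ := hx i
    rw [abs_sub_comm] at h₁
    have h₃ := abs_sub_le (w i) (x i) (c i)
    linarith
  have hball : ℓ⁻¹ • (w - c) ∈ Metric.closedBall (0 : Fin n → ℝ) 1 := by
    rw [mem_closedBall_zero_iff, pi_norm_le_iff_of_nonneg zero_le_one]
    intro i
    rw [Pi.smul_apply, Pi.sub_apply, smul_eq_mul, Real.norm_eq_abs, abs_mul, abs_inv,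
      abs_of_pos hℓ, inv_mul_le_iff₀ hℓ]
    linarith [hwc i]
  obtain ⟨g, hg, hgw⟩ := Set.mem_iUnion₂.1 (hT hball)
  have hgi : ∀ i, |w i - (c + ℓ • g) i| < h * ℓ := fun i => by
    have h₁ := (dist_pi_lt_iff hh₀).1 hgw i
    rw [Real.dist_eq] at h₁
    have h₂ : w i - (c + ℓ • g) i = ((ℓ⁻¹ • (w - c)) i - g i) * ℓ := by
      simp only [Pi.add_apply, Pi.smul_apply, Pi.sub_apply, smul_eq_mul]
      field_simp
      ring
    rw [h₂, abs_mul, abs_of_pos hℓ]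
    gcongr
  have hzw : ∀ z ∈ cube (c + ℓ • g) (2 * h * ℓ), ∀ i, |z i - w i| < 2 * h * ℓ :=
    fun z hz i => by
      have h₁ := hz i
      have h₂ := hgi i
      rw [abs_sub_comm] at h₂
      have h₃ := abs_sub_le (z i) ((c + ℓ • g) i) (w i)
      linarith
  refine ⟨g, hg, fun z hz i => ?_, fun z hz => ?_⟩
  · have h₁ := hzw z hz i
    have h₂ := abs_sub_le (z i) (w i) (c i)
    have h₃ := hwc i
    nlinarith
  · have h₁ := eudist_lt_of_forall_abs_sub_lt (by positivity) (hzw z hz)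
    have h₂ := eudist_triangle z w y
    have h₃ : (n + 1) * (2 * h * ℓ) = ℓ / 8 := by linear_combination ℓ / 8 * hh
    linarith

/-- There is `C` depending only on `n` such that for every measurable
`u : ℝ^{n+1}_+ → ℂ` and every cube `Q ⊆ ℝⁿ` (center `c`, side `ℓ > 0`):
`∫_Q ∫_{ℓ(Q)/4}^∞ ∫_{|x−y|<t} |u(y,t)|² t^{1−n} dy dt dx
  ≤ C |Q| ( ⨍_{2Q} A₂⁺(tu)(z) dz )²`. -/
theorem statement2 (n : ℕ) :
    ∃ C : ℝ≥0∞, 0 < C ∧ C < ⊤ ∧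
      ∀ u : (Fin n → ℝ) × ℝ → ℂ, Measurable u →
        ∀ (c : Fin n → ℝ) (ℓ : ℝ), 0 < ℓ →
          (∫⁻ x in cube c ℓ,
              ∫⁻ p in {p : (Fin n → ℝ) × ℝ | ℓ / 4 < p.2 ∧ eudist x p.1 < p.2},
                (‖u p‖₊ : ℝ≥0∞) ^ 2 * ENNReal.ofReal (p.2 ^ ((1 : ℝ) - n))) ≤
            C * volume (cube c ℓ) *
              ((∫⁻ z in cube c (2 * ℓ), lusin (fun p => (‖u p‖₊ : ℝ≥0∞) ^ 2) z) /
                  volume (cube c (2 * ℓ))) ^ 2 := by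
  obtain ⟨h, hh₀, hh⟩ : ∃ h : ℝ, 0 < h ∧ 16 * (n + 1) * h = 1 :=
    ⟨(16 * ((n : ℝ) + 1))⁻¹, by positivity, mul_inv_cancel₀ (by positivity)⟩
  obtain ⟨T, -, hTfin, hT⟩ :=
    (isCompact_closedBall (0 : Fin n → ℝ) 1).finite_cover_balls hh₀
  lift T to Finset (Fin n → ℝ) using hTfin
  set K : ℝ≥0∞ := ENNReal.ofReal h⁻¹ ^ n with hK
  refine ⟨(#T + 1) * K ^ 2, ?_, ?_, fun u _ c ℓ hℓ => ?_⟩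
  · have : 0 < K := by positivity
    positivity
  · exact ENNReal.mul_lt_top (by finiteness) (by finiteness)
  set G : (Fin n → ℝ) × ℝ → ℝ≥0∞ := fun p => (‖u p‖₊ : ℝ≥0∞) ^ 2
  set M := (∫⁻ z in cube c (2 * ℓ), lusin G z) / volume (cube c (2 * ℓ))
  set S : (Fin n → ℝ) → Set ((Fin n → ℝ) × ℝ) := fun g =>
    {p | cube (c + ℓ • g) (2 * h * ℓ) ⊆ cube c (2 * ℓ) ∧ 0 < p.2 ∧
      ∀ z ∈ cube (c + ℓ • g) (2 * h * ℓ), eudist z p.1 < p.2}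
  have hSM : ∀ g, ∫⁻ p in S g, G p * ENNReal.ofReal (p.2 ^ ((1 : ℝ) - n)) ≤ K ^ 2 * M ^ 2 := by
    intro g
    by_cases hsub : cube (c + ℓ • g) (2 * h * ℓ) ⊆ cube c (2 * ℓ)
    · refine setLIntegral_le_average_lusin G (measurableSet_cube _ _) hsub ?_ ?_ ?_
        fun p hp => hp.2
      · rw [volume_cube]
        have : 0 < 2 * h * ℓ := by positivity
        positivity
      · rw [volume_cube]
        finiteness
      · rw [volume_cube, volume_cube, hK, ← mul_pow, ← ENNReal.ofReal_mul (by positivity)]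
        congr 2
        field_simp
    · have hempty : S g = ∅ := Set.eq_empty_of_forall_notMem fun p hp => hsub hp.1
      simp [hempty]
  have hcone : ∀ x ∈ cube c ℓ,
      ∫⁻ p in {p : (Fin n → ℝ) × ℝ | ℓ / 4 < p.2 ∧ eudist x p.1 < p.2},
        G p * ENNReal.ofReal (p.2 ^ ((1 : ℝ) - n)) ≤ #T * (K ^ 2 * M ^ 2) := by
    intro x hx
    calc _ ≤ ∫⁻ p in ⋃ g : T, S g, G p * ENNReal.ofReal (p.2 ^ ((1 : ℝ) - n)) := by
          refine lintegral_mono_set fun p hp => ?_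
          obtain ⟨g, hg, hsub, hgp⟩ := exists_cube_subset_cone hh hT hℓ hx hp.1 hp.2
          exact Set.mem_iUnion.2 ⟨⟨g, hg⟩, hsub, by linarith [hp.1], hgp⟩
      _ ≤ ∑ g ∈ T, ∫⁻ p in S g, G p * ENNReal.ofReal (p.2 ^ ((1 : ℝ) - n)) := by
          rw [← Finset.tsum_subtype T fun g =>
            ∫⁻ p in S g, G p * ENNReal.ofReal (p.2 ^ ((1 : ℝ) - n))]
          exact lintegral_iUnion_le _ _
      _ ≤ #T * (K ^ 2 * M ^ 2) := by
          simpa using Finset.sum_le_card_nsmul T _ _ fun g _ => hSM g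
  calc _ ≤ ∫⁻ _ in cube c ℓ, #T * (K ^ 2 * M ^ 2) :=
        setLIntegral_mono' (measurableSet_cube _ _) hcone
    _ = #T * K ^ 2 * volume (cube c ℓ) * M ^ 2 := by
        rw [setLIntegral_const]
        ring
    _ ≤ _ := by
        gcongr
        exact le_self_add

end
end

section
/- For each n ≥ 1 and N ≥ 1 there exists ε > 0 depending only on n with the following property. Let u ∈ L²_loc(ℝ^{n+1}_+; ℂ^N) satisfy A₂⁺(t u) ∈ L²(ℝⁿ). Suppose there is a nonnegative φ ∈ L²_loc(ℝⁿ) and, for each cube Q ⊂ ℝⁿ, a function u_Q ∈ L²_loc(ℝ^{n+1}_+; ℂ^N) such that ‖A₂⁺(t u_Q)‖²_{L²(ℝⁿ)} + ∫_{(3/2)Q} ∫_0^{ℓ(Q)/4} |u(x,t) − u_Q(x,t)|² t dt dx ≤ ‖φ‖²_{L²(4Q)}. Then for every p with 2 ≤ p < 2+ε there is a constant C_p depending only on n and p such that, if φ ∈ L^p(ℝⁿ), then ‖A₂⁺(t u)‖_{L^p(ℝⁿ)} ≤ C_p ‖φ‖_{L^p(ℝⁿ)}. -/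
/- STATEMENT 3: Good-lambda/self-improvement lemma for area integrals
(first part of Lemma `lem:lusin:+` of the paper). -/

open MeasureTheory ENNReal Set Finset
noncomputable section

/-- The upper half space `ℝ^{n+1}_+ = ℝⁿ × (0,∞)`. -/
def upperHalf (n : ℕ) : Set ((Fin n → ℝ) × ℝ) := {p | 0 < p.2}

/-- `G` (a squared-magnitude density) is locally integrable on `Ω`
(i.e. the underlying function is in `L²_loc(Ω)`). -/
def L2loc {n : ℕ} (Ω : Set ((Fin n → ℝ) × ℝ)) (G : (Fin n → ℝ) × ℝ → ℝ≥0∞) : Prop :=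
  ∀ K : Set ((Fin n → ℝ) × ℝ), K ⊆ Ω → IsCompact K → (∫⁻ p in K, G p) < ⊤

section Tails

variable {α : Type*} [MeasurableSpace α] {ν : Measure α} {τ : α → ℝ}

lemma measurable_tail (hτ : Measurable τ) : Measurable fun a => ν {b | τ a ≤ τ b} := by
  have h : Antitone fun s : ℝ => ν {b | s ≤ τ b} :=
    fun s s' hs => measure_mono fun b hb => le_trans hs hb
  exact h.measurable.comp hτ

/-- The tail function `a ↦ ν {τ a ≤ τ}` of a measure has stochastically small sublevel sets. -/
lemma measure_tail_le_le (ν : Measure α) (τ : α → ℝ) (c : ℝ≥0∞) :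
    ν {a | ν {b | τ a ≤ τ b} ≤ c} ≤ c := by
  set E : Set ℝ := {s | ν {b | s ≤ τ b} ≤ c} with hE
  have hup : ∀ s ∈ E, ∀ s', s ≤ s' → s' ∈ E := fun s hs s' hss =>
    (measure_mono fun b (hb : s' ≤ τ b) => le_trans hss hb).trans hs
  change ν {a | τ a ∈ E} ≤ c
  by_cases hmin : ∃ m ∈ E, ∀ s ∈ E, m ≤ s
  · obtain ⟨m, hm, hle⟩ := hmin
    exact (measure_mono fun a (ha : τ a ∈ E) => hle _ ha).trans hm
  · push Not at hmin
    have hsub : {a | τ a ∈ E} ⊆ ⋃ q ∈ {q : ℚ | (q : ℝ) ∈ E}, {b | (q : ℝ) ≤ τ b} := by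
      intro a ha
      obtain ⟨s, hs, hlt⟩ := hmin _ ha
      obtain ⟨q, hq1, hq2⟩ := exists_rat_btwn hlt
      simp only [mem_iUnion]
      exact ⟨q, hup s hs _ hq1.le, hq2.le⟩
    refine (measure_mono hsub).trans ?_
    rw [measure_biUnion_eq_iSup (to_countable _)]
    · exact iSup₂_le fun q hq => hq
    · intro q hq r hr
      rcases le_total q r with h | h
      · exact ⟨q, hq, subset_rfl, fun b (hb : (r : ℝ) ≤ τ b) =>
          le_trans (by exact_mod_cast h) hb⟩
      · exact ⟨r, hr, fun b (hb : (q : ℝ) ≤ τ b) =>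
          le_trans (by exact_mod_cast h) hb, subset_rfl⟩

lemma rpow_antitone_of_nonpos {a b : ℝ≥0∞} {z : ℝ} (hz : z ≤ 0) (h : a ≤ b) :
    b ^ z ≤ a ^ z := by
  have := ENNReal.inv_le_inv.2 (ENNReal.rpow_le_rpow h (neg_nonneg.2 hz))
  rwa [← ENNReal.rpow_neg, ← ENNReal.rpow_neg, neg_neg] at this

lemma rpow_eq_mul_rpow_sub_one {a : ℝ≥0∞} (ha : a ≠ ⊤) (h0 : a ≠ 0) (δ : ℝ) :
    a ^ δ = a ^ (δ - 1) * a := by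
  conv_lhs => rw [show δ = (δ - 1) + 1 by ring]
  rw [ENNReal.rpow_add _ _ h0 ha, ENNReal.rpow_one]

lemma sq_measure_univ_le [IsFiniteMeasure ν] (hτ : Measurable τ) :
    ν univ * ν univ ≤ 2 * ∫⁻ a, ν {b | τ a ≤ τ b} ∂ν := by
  have hm : MeasurableSet {p : α × α | τ p.1 ≤ τ p.2} :=
    measurableSet_le (hτ.comp measurable_fst) (hτ.comp measurable_snd)
  have hm' : MeasurableSet {p : α × α | τ p.2 ≤ τ p.1} :=
    measurableSet_le (hτ.comp measurable_snd) (hτ.comp measurable_fst)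
  have h1 : (ν.prod ν) {p : α × α | τ p.1 ≤ τ p.2} = ∫⁻ a, ν {b | τ a ≤ τ b} ∂ν :=
    Measure.prod_apply hm
  have h2 : (ν.prod ν) {p : α × α | τ p.2 ≤ τ p.1} = ∫⁻ a, ν {b | τ a ≤ τ b} ∂ν :=
    Measure.prod_apply_symm hm'
  calc ν univ * ν univ = (ν.prod ν) univ := by rw [← univ_prod_univ, Measure.prod_prod]
    _ ≤ (ν.prod ν) ({p : α × α | τ p.1 ≤ τ p.2} ∪ {p : α × α | τ p.2 ≤ τ p.1}) :=
        measure_mono fun p _ => le_total (τ p.1) (τ p.2)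
    _ ≤ _ := measure_union_le _ _
    _ = _ := by rw [h1, h2, two_mul]

lemma measure_univ_rpow_le [IsFiniteMeasure ν] (hτ : Measurable τ) {δ : ℝ} (h0 : 0 < δ)
    (h1 : δ < 1) :
    ν univ ^ (1 + δ) ≤ 2 * ∫⁻ a, ν {b | τ a ≤ τ b} ^ δ ∂ν := by
  rcases eq_or_ne (ν univ) 0 with hz | hz
  · rw [hz, ENNReal.zero_rpow_of_pos (by linarith)]; exact zero_le
  have hpt : ∀ a, ν univ ^ (δ - 1) * ν {b | τ a ≤ τ b} ≤ ν {b | τ a ≤ τ b} ^ δ := by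
    intro a
    rcases eq_or_ne (ν {b | τ a ≤ τ b}) 0 with h | h
    · simp [h]
    · rw [rpow_eq_mul_rpow_sub_one (measure_ne_top _ _) h]
      exact mul_le_mul_left (rpow_antitone_of_nonpos (by linarith)
        (measure_mono (Set.subset_univ _))) _
  calc ν univ ^ (1 + δ) = ν univ ^ (δ - 1) * (ν univ * ν univ) := by
        rw [ENNReal.rpow_add _ _ hz (measure_ne_top _ _), ENNReal.rpow_one,
          rpow_eq_mul_rpow_sub_one (measure_ne_top _ _) hz]
        ring
    _ ≤ ν univ ^ (δ - 1) * (2 * ∫⁻ a, ν {b | τ a ≤ τ b} ∂ν) := by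
        exact mul_le_mul_right (sq_measure_univ_le hτ) _
    _ = 2 * ∫⁻ a, ν univ ^ (δ - 1) * ν {b | τ a ≤ τ b} ∂ν := by
        rw [lintegral_const_mul _ (measurable_tail hτ)]; ring
    _ ≤ _ := by gcongr with a; exact hpt a

lemma tail_rpow_le [IsFiniteMeasure ν] (hτ : Measurable τ) {δ : ℝ} (h0 : 0 < δ)
    (h1 : δ < 1) (s : ℝ) :
    ν {b | s ≤ τ b} ^ δ ≤ ∫⁻ a in {a | s ≤ τ a}, ν {b | τ a ≤ τ b} ^ (δ - 1) ∂ν := by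
  rcases eq_or_ne (ν {b | s ≤ τ b}) 0 with hz | hz
  · rw [hz, ENNReal.zero_rpow_of_pos h0]; exact zero_le
  rw [rpow_eq_mul_rpow_sub_one (measure_ne_top _ _) hz, ← setLIntegral_const]
  refine setLIntegral_mono' (measurableSet_le measurable_const hτ) fun a ha => ?_
  exact rpow_antitone_of_nonpos (by linarith) (measure_mono
    fun b (hb : τ a ≤ τ b) => le_trans (show s ≤ τ a from ha) hb)

lemma rpow_neg_le_tsum {β : ℝ} (hβ : 0 ≤ β) {V g : ℝ≥0∞} (hV : V ≠ ⊤) (hg : g ≠ 0)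
    (hgV : g ≤ V) :
    g ^ (-β) ≤ ∑' m : ℕ, (V * (2⁻¹) ^ (m + 1)) ^ (-β) *
      ({x : ℝ≥0∞ | x ≤ V * (2⁻¹) ^ m}.indicator 1 g) := by
  have hex : ∃ m : ℕ, V * (2⁻¹) ^ (m + 1) < g := by
    have ht : Filter.Tendsto (fun m : ℕ => V * (2⁻¹ : ℝ≥0∞) ^ (m + 1)) Filter.atTop
        (nhds (V * 0)) := by
      refine ENNReal.Tendsto.const_mul ?_ (Or.inr hV)
      exact (ENNReal.tendsto_pow_atTop_nhds_zero_of_lt_one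
        (by simp)).comp (Filter.tendsto_add_atTop_nat 1)
    rw [mul_zero] at ht
    exact (ht.eventually (gt_mem_nhds (pos_iff_ne_zero.2 hg))).exists
  classical
  set m := Nat.find hex with hm
  have h1 : V * (2⁻¹) ^ (m + 1) < g := Nat.find_spec hex
  have h2 : g ≤ V * (2⁻¹) ^ m := by
    rcases Nat.eq_zero_or_pos m with h | h
    · rw [h]; simpa using hgV
    · have := Nat.find_min hex (m := m - 1) (by omega)
      rw [Nat.sub_add_cancel h] at this
      exact not_lt.1 this
  refine le_trans ?_ (ENNReal.le_tsum m)
  rw [indicator_of_mem (by exact h2)]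
  simpa using rpow_antitone_of_nonpos (by linarith) h1.le

/-- The constant in `lintegral_tail_rpow_le`. -/
def tailConst (δ : ℝ) : ℝ≥0∞ := 2 ^ (1 - δ) * (1 - (2⁻¹ : ℝ≥0∞) ^ δ)⁻¹

lemma tailConst_ne_top {δ : ℝ} (h0 : 0 < δ) : tailConst δ ≠ ⊤ := by
  refine ENNReal.mul_ne_top (by simp) (ENNReal.inv_ne_top.2 ?_)
  exact (tsub_pos_of_lt (ENNReal.rpow_lt_one (by simp) h0)).ne'

lemma lintegral_tail_rpow_le [IsFiniteMeasure ν] (hτ : Measurable τ) {δ : ℝ} (h1 : δ < 1) :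
    ∫⁻ a, ν {b | τ a ≤ τ b} ^ (δ - 1) ∂ν ≤ tailConst δ * ν univ ^ δ := by
  set V := ν univ with hVdef
  have hV : V ≠ ⊤ := measure_ne_top _ _
  rcases eq_or_ne V 0 with hz | hz
  · rw [Measure.measure_univ_eq_zero.1 hz]; simp
  have hae : ∀ᵐ a ∂ν, ν {b | τ a ≤ τ b} ≠ 0 := by
    have := measure_tail_le_le ν τ 0
    rw [nonpos_iff_eq_zero] at this
    rw [ae_iff]
    simpa using this
  have hmeas := measurable_tail (ν := ν) hτ
  have hS : ∀ c : ℝ≥0∞, MeasurableSet {x : ℝ≥0∞ | x ≤ c} := fun c => measurableSet_Iic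
  have hterm : ∀ m : ℕ, (V * (2⁻¹ : ℝ≥0∞) ^ (m + 1)) ^ (δ - 1) * (V * (2⁻¹) ^ m) =
      (2 ^ (1 - δ) * V ^ δ) * ((2⁻¹ : ℝ≥0∞) ^ δ) ^ m := by
    intro m
    have h2 : (2⁻¹ : ℝ≥0∞) ^ (δ - 1) = 2 ^ (1 - δ) := by
      rw [ENNReal.inv_rpow, ← ENNReal.rpow_neg]; congr 1; ring
    have hp : (2⁻¹ : ℝ≥0∞) ^ m ≠ 0 := by simp
    have hp' : (2⁻¹ : ℝ≥0∞) ^ m ≠ ⊤ := by simp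
    have hw : ((2⁻¹ : ℝ≥0∞) ^ δ) ^ m = ((2⁻¹ : ℝ≥0∞) ^ m) ^ δ := by
      rw [← ENNReal.rpow_natCast, ← ENNReal.rpow_natCast, ← ENNReal.rpow_mul,
        ← ENNReal.rpow_mul, mul_comm]
    rw [hw, pow_succ, ENNReal.mul_rpow_of_ne_top hV (ENNReal.mul_ne_top hp' (by simp)),
      ENNReal.mul_rpow_of_ne_top hp' (by simp), h2, rpow_eq_mul_rpow_sub_one hV hz δ,
      rpow_eq_mul_rpow_sub_one hp' hp δ]
    ring
  calc ∫⁻ a, ν {b | τ a ≤ τ b} ^ (δ - 1) ∂ν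
      ≤ ∫⁻ a, ∑' m : ℕ, (V * (2⁻¹) ^ (m + 1)) ^ (δ - 1) *
      ({x : ℝ≥0∞ | x ≤ V * (2⁻¹) ^ m}.indicator 1 (ν {b | τ a ≤ τ b})) ∂ν := by
        refine lintegral_mono_ae (hae.mono fun a ha => ?_)
        have := rpow_neg_le_tsum (β := 1 - δ) (by linarith) hV ha (measure_mono (Set.subset_univ _))
        simpa only [neg_sub] using this
    _ = ∑' m : ℕ, (V * (2⁻¹) ^ (m + 1)) ^ (δ - 1) *
          ν {a | ν {b | τ a ≤ τ b} ≤ V * (2⁻¹) ^ m} := by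
        rw [lintegral_tsum]
        · congr 1; ext m
          rw [lintegral_const_mul _ (f := fun a => {x : ℝ≥0∞ | x ≤ V * (2⁻¹) ^ m}.indicator 1
            (ν {b | τ a ≤ τ b})) ((measurable_one.indicator (hS _)).comp hmeas)]
          congr 1
          exact lintegral_indicator_one (hmeas (hS _))
        · intro m
          exact (((measurable_one.indicator (hS _)).comp hmeas).const_mul _).aemeasurable
    _ ≤ ∑' m : ℕ, (V * (2⁻¹) ^ (m + 1)) ^ (δ - 1) * (V * (2⁻¹) ^ m) := by
        gcongr; exact measure_tail_le_le ν τ _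
    _ = tailConst δ * V ^ δ := by
        simp_rw [hterm]
        rw [ENNReal.tsum_mul_left, ENNReal.tsum_geometric, tailConst]
        ring

end Tails

section Kernel

variable {n : ℕ}

/-- The Poisson-type kernel `t / (t + ‖x - y‖) ^ (n + 1)` at `q = (y, t)`. -/
def ker (q : (Fin n → ℝ) × ℝ) (x : Fin n → ℝ) : ℝ≥0∞ :=
  ENNReal.ofReal (q.2 / (q.2 + ‖x - q.1‖) ^ (n + 1))

lemma measurable_ker_uncurry :
    Measurable fun z : ((Fin n → ℝ) × ℝ) × (Fin n → ℝ) => ker z.1 z.2 := by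
  unfold ker; fun_prop

@[fun_prop]
lemma Measurable.ker_comp {β : Type*} [MeasurableSpace β] {f : β → (Fin n → ℝ) × ℝ}
    {g : β → Fin n → ℝ} (hf : Measurable f) (hg : Measurable g) :
    Measurable fun b => ker (f b) (g b) :=
  measurable_ker_uncurry.comp (hf.prodMk hg)

lemma div_pow_le_mul_div_pow {t t' A B c : ℝ} (ht : 0 ≤ t) (htt : t ≤ t') (hB : 0 < B)
    (hc : 0 < c) (h : B ≤ c * A) (m : ℕ) : t / A ^ m ≤ c ^ m * (t' / B ^ m) := by
  have hA : 0 < A := by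
    by_contra hA
    nlinarith
  rw [← mul_div_assoc, div_le_div_iff₀ (by positivity) (by positivity)]
  calc t * B ^ m ≤ t' * (c * A) ^ m := by gcongr; exact ht.trans htt
    _ = c ^ m * t' * A ^ m := by rw [mul_pow]; ring

lemma ofReal_le_pow_mul_ofReal {c : ℕ} {m : ℕ} {a b : ℝ} (h : a ≤ (c : ℝ) ^ m * b) :
    ENNReal.ofReal a ≤ (c : ℝ≥0∞) ^ m * ENNReal.ofReal b := by
  refine (ENNReal.ofReal_le_ofReal h).trans_eq ?_
  rw [ENNReal.ofReal_mul (by positivity), ENNReal.ofReal_pow (by positivity),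
    ENNReal.ofReal_natCast]

lemma ker_harnack {q : (Fin n → ℝ) × ℝ} (hq : 0 < q.2) {x x' : Fin n → ℝ}
    (h : ‖x - x'‖ ≤ 16 * q.2) : ker q x ≤ (17 : ℕ) ^ (n + 1) * ker q x' := by
  refine ofReal_le_pow_mul_ofReal (div_pow_le_mul_div_pow hq.le le_rfl (by positivity)
    (by norm_num) ?_ _)
  have : ‖x' - q.1‖ ≤ ‖x - x'‖ + ‖x - q.1‖ := by
    rw [norm_sub_rev x x', show x' - q.1 = (x' - x) + (x - q.1) by abel]
    exact norm_add_le _ _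
  have := norm_nonneg (x - q.1)
  push_cast
  linarith

lemma ker_mul_ker_le {q q' : (Fin n → ℝ) × ℝ} (hq : 0 < q.2) (hqq : q.2 ≤ q'.2)
    (x : Fin n → ℝ) :
    ker q x * ker q' x ≤ (2 : ℕ) ^ (n + 1) * ker q' q.1 * (ker q x + ker q' x) := by
  have htri : ‖q.1 - q'.1‖ ≤ ‖x - q.1‖ + ‖x - q'.1‖ := by
    rw [norm_sub_rev x q.1, show q.1 - q'.1 = (q.1 - x) + (x - q'.1) by abel]
    exact norm_add_le _ _
  have hq' : 0 < q'.2 := hq.trans_le hqq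
  rcases le_total ‖x - q.1‖ (q'.2 + ‖x - q'.1‖) with h | h
  · have : ker q' x ≤ (2 : ℕ) ^ (n + 1) * ker q' q.1 :=
      ofReal_le_pow_mul_ofReal (div_pow_le_mul_div_pow hq'.le le_rfl (by positivity)
        (by norm_num) (by push_cast; linarith) _)
    calc ker q x * ker q' x ≤ ker q x * ((2 : ℕ) ^ (n + 1) * ker q' q.1) := by gcongr
      _ = (2 : ℕ) ^ (n + 1) * ker q' q.1 * ker q x := mul_comm _ _
      _ ≤ _ := by gcongr; exact le_self_add
  · have : ker q x ≤ (2 : ℕ) ^ (n + 1) * ker q' q.1 :=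
      ofReal_le_pow_mul_ofReal (div_pow_le_mul_div_pow hq.le hqq (by positivity)
        (by norm_num) (by push_cast; linarith) _)
    calc ker q x * ker q' x ≤ ((2 : ℕ) ^ (n + 1) * ker q' q.1) * ker q' x := by gcongr
      _ ≤ _ := by gcongr; exact le_add_self

lemma ker_le_of_le {q : (Fin n → ℝ) × ℝ} {t : ℝ} (ht : 0 < t) (hq : t ≤ q.2)
    (x : Fin n → ℝ) : ker q x ≤ ENNReal.ofReal ((t ^ n)⁻¹) := by
  have hq0 : 0 < q.2 := ht.trans_le hq
  refine ENNReal.ofReal_le_ofReal ?_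
  rw [← one_div, div_le_div_iff₀ (by positivity) (by positivity), one_mul]
  calc q.2 * t ^ n ≤ (q.2 + ‖x - q.1‖) * (q.2 + ‖x - q.1‖) ^ n := by
        gcongr
        · linarith [norm_nonneg (x - q.1)]
        · linarith [norm_nonneg (x - q.1)]
    _ = _ := by rw [pow_succ]; ring

lemma le_ker_of_norm_le {q : (Fin n → ℝ) × ℝ} (hq : 0 < q.2) {x : Fin n → ℝ}
    (h : ‖x - q.1‖ ≤ q.2) : ENNReal.ofReal ((q.2 ^ n)⁻¹) ≤ (2 : ℕ) ^ (n + 1) * ker q x := by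
  have h1 : (q.2 ^ n)⁻¹ = q.2 / q.2 ^ (n + 1) := by
    rw [pow_succ]; field_simp
  rw [h1]
  exact ofReal_le_pow_mul_ofReal (div_pow_le_mul_div_pow hq.le le_rfl (by positivity)
    (by norm_num) (by push_cast; linarith) _)

/-- The total mass of the kernel. -/
def kerMass (n : ℕ) : ℝ≥0∞ :=
  ∫⁻ z : Fin n → ℝ, ENNReal.ofReal ((1 + ‖z‖) ^ (-((n : ℝ) + 1)))

lemma kerMass_ne_top (n : ℕ) : kerMass n ≠ ⊤ :=
  (finite_integral_one_add_norm (by simp)).ne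

lemma lintegral_ker {q : (Fin n → ℝ) × ℝ} (hq : 0 < q.2) : ∫⁻ x, ker q x = kerMass n := by
  set g : (Fin n → ℝ) → ℝ≥0∞ := fun z => ENNReal.ofReal ((1 + ‖z‖) ^ (-((n : ℝ) + 1))) with hg
  have hgm : Measurable g := by fun_prop
  have hpt : ∀ x, ENNReal.ofReal (q.2 / (q.2 + ‖x‖) ^ (n + 1)) =
      ENNReal.ofReal ((q.2 ^ n)⁻¹) * g (q.2⁻¹ • x) := by
    intro x
    rw [hg, ← ENNReal.ofReal_mul (by positivity)]
    congr 1
    have hpos : 0 < 1 + ‖q.2⁻¹ • x‖ := by positivity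
    rw [Real.rpow_neg hpos.le, show ((n : ℝ) + 1) = ((n + 1 : ℕ) : ℝ) by push_cast; ring,
      Real.rpow_natCast, norm_smul, norm_inv, Real.norm_of_nonneg hq.le,
      show q.2 + ‖x‖ = q.2 * (1 + q.2⁻¹ * ‖x‖) by field_simp, mul_pow, pow_succ q.2]
    have : 0 < 1 + q.2⁻¹ * ‖x‖ := by positivity
    field_simp
  have hscale : ∫⁻ x, g (q.2⁻¹ • x) = ENNReal.ofReal (q.2 ^ n) * ∫⁻ x, g x := by
    rw [← lintegral_map hgm (measurable_const_smul _),
      Measure.map_addHaar_smul _ (inv_ne_zero hq.ne'), lintegral_smul_measure, smul_eq_mul]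
    congr 2
    rw [Module.finrank_fin_fun, inv_pow, inv_inv, abs_of_pos (by positivity)]
  unfold ker
  rw [lintegral_sub_right_eq_self (fun x => ENNReal.ofReal (q.2 / (q.2 + ‖x‖) ^ (n + 1))) q.1]
  simp_rw [hpt]
  rw [lintegral_const_mul _ (f := fun x => g (q.2⁻¹ • x)) (hgm.comp (measurable_const_smul _)),
    hscale, ← mul_assoc,
    ← ENNReal.ofReal_mul (by positivity), inv_mul_cancel₀ (by positivity), ENNReal.ofReal_one,
    one_mul]
  rfl

end Kernel

section Tent

variable {n : ℕ} {μ : Measure ((Fin n → ℝ) × ℝ)}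

/-- The part at heights `≥ s` of the smoothed area function of `μ`. -/
def tailArea (μ : Measure ((Fin n → ℝ) × ℝ)) (s : ℝ) (x : Fin n → ℝ) : ℝ≥0∞ :=
  ∫⁻ q in {q | s ≤ q.2}, ker q x ∂μ

lemma measurableSet_height_ge (s : ℝ) :
    MeasurableSet {q : (Fin n → ℝ) × ℝ | s ≤ q.2} :=
  measurableSet_le measurable_const measurable_snd

lemma measurable_tailArea_uncurry [SFinite μ] :
    Measurable fun z : ℝ × (Fin n → ℝ) => tailArea μ z.1 z.2 := by
  have h : ∀ z : ℝ × (Fin n → ℝ), tailArea μ z.1 z.2 =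
      ∫⁻ q, {w : (ℝ × (Fin n → ℝ)) × ((Fin n → ℝ) × ℝ) | w.1.1 ≤ w.2.2}.indicator
        (fun w => ker w.2 w.1.2) (z, q) ∂μ := by
    intro z
    rw [tailArea, ← lintegral_indicator (measurableSet_height_ge _)]
    rfl
  simp_rw [h]
  refine Measurable.lintegral_prod_right' (Measurable.indicator (by fun_prop) ?_)
  exact measurableSet_le (by fun_prop) (by fun_prop)

@[fun_prop]
lemma Measurable.tailArea_comp [SFinite μ] {β : Type*} [MeasurableSpace β] {f : β → ℝ}
    {g : β → Fin n → ℝ} (hf : Measurable f) (hg : Measurable g) :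
    Measurable fun b => tailArea μ (f b) (g b) :=
  measurable_tailArea_uncurry.comp (hf.prodMk hg)

lemma measurable_area [SFinite μ] : Measurable fun x => ∫⁻ q, ker q x ∂μ :=
  Measurable.lintegral_prod_right' (f := fun z : (Fin n → ℝ) × ((Fin n → ℝ) × ℝ) =>
    ker z.2 z.1) (by fun_prop)

lemma withDensity_ker_height_ge (x : Fin n → ℝ) (s : ℝ) :
    μ.withDensity (fun q => ker q x) {q | s ≤ q.2} = tailArea μ s x :=
  withDensity_apply _ (measurableSet_height_ge s)

lemma withDensity_ker_univ (x : Fin n → ℝ) :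
    μ.withDensity (fun q => ker q x) univ = ∫⁻ q, ker q x ∂μ := by
  rw [withDensity_apply _ MeasurableSet.univ, Measure.restrict_univ]

lemma area_rpow_le [SFinite μ] {δ : ℝ} (h0 : 0 < δ) (h1 : δ < 1) {x : Fin n → ℝ}
    (hx : ∫⁻ q, ker q x ∂μ ≠ ⊤) :
    (∫⁻ q, ker q x ∂μ) ^ (1 + δ) ≤ 2 * ∫⁻ q, ker q x * tailArea μ q.2 x ^ δ ∂μ := by
  have := isFiniteMeasure_withDensity hx
  have := measure_univ_rpow_le (ν := μ.withDensity (fun q => ker q x))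
    (τ := Prod.snd) measurable_snd h0 h1
  simp_rw [withDensity_ker_height_ge] at this
  rwa [withDensity_ker_univ, lintegral_withDensity_eq_lintegral_mul _ (by fun_prop)
    (by fun_prop)] at this

lemma tailArea_rpow_le [SFinite μ] {δ : ℝ} (h0 : 0 < δ) (h1 : δ < 1) {x : Fin n → ℝ}
    (hx : ∫⁻ q, ker q x ∂μ ≠ ⊤) (s : ℝ) :
    tailArea μ s x ^ δ ≤
      ∫⁻ q in {q | s ≤ q.2}, ker q x * tailArea μ q.2 x ^ (δ - 1) ∂μ := by
  have := isFiniteMeasure_withDensity hx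
  have := tail_rpow_le (ν := μ.withDensity (fun q => ker q x))
    (τ := Prod.snd) measurable_snd h0 h1 s
  simp_rw [withDensity_ker_height_ge] at this
  rwa [restrict_withDensity (measurableSet_height_ge s),
    lintegral_withDensity_eq_lintegral_mul _ (by fun_prop) (by fun_prop)] at this

lemma lintegral_ker_mul_tailArea_rpow_le [SFinite μ] {δ : ℝ} (h1 : δ < 1) {x : Fin n → ℝ}
    (hx : ∫⁻ q, ker q x ∂μ ≠ ⊤) :
    ∫⁻ q, ker q x * tailArea μ q.2 x ^ (δ - 1) ∂μ ≤
      tailConst δ * (∫⁻ q, ker q x ∂μ) ^ δ := by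
  have := isFiniteMeasure_withDensity hx
  have := lintegral_tail_rpow_le (ν := μ.withDensity (fun q => ker q x))
    (τ := Prod.snd) measurable_snd h1
  simp_rw [withDensity_ker_height_ge] at this
  rwa [withDensity_ker_univ, lintegral_withDensity_eq_lintegral_mul _ (by fun_prop)
    (by fun_prop)] at this

/-- Averaging against the kernel at a lower height does not increase the tails of the
area function. -/
lemma lintegral_ker_mul_tailArea_le [SFinite μ] {q : (Fin n → ℝ) × ℝ} (hq : 0 < q.2) :
    ∫⁻ x, ker q x * tailArea μ q.2 x ≤
      ((2 : ℕ) ^ (n + 1) * (2 * kerMass n)) * tailArea μ q.2 q.1 := by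
  have h1 : ∀ x, ker q x * tailArea μ q.2 x =
      ∫⁻ q' in {q' | q.2 ≤ q'.2}, ker q x * ker q' x ∂μ := fun x => by
    rw [tailArea, lintegral_const_mul _ (by fun_prop)]
  simp_rw [h1]
  rw [lintegral_lintegral_swap (by unfold Function.uncurry; fun_prop), tailArea,
    ← lintegral_const_mul _ (by fun_prop)]
  refine setLIntegral_mono' (measurableSet_height_ge _) fun q' hq' => ?_
  calc ∫⁻ x, ker q x * ker q' x
      ≤ ∫⁻ x, (2 : ℕ) ^ (n + 1) * ker q' q.1 * (ker q x + ker q' x) :=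
        lintegral_mono fun x => ker_mul_ker_le hq hq' x
    _ = (2 : ℕ) ^ (n + 1) * ker q' q.1 * (2 * kerMass n) := by
        rw [lintegral_const_mul _ (by fun_prop), lintegral_add_left (by fun_prop),
          lintegral_ker hq, lintegral_ker (hq.trans_le hq'), two_mul]
    _ = _ := by ring

lemma lintegral_ker_mul_tailArea_rpow_space_le [SFinite μ] {δ : ℝ} (h0 : 0 < δ) (h1 : δ < 1)
    {q : (Fin n → ℝ) × ℝ} (hq : 0 < q.2) :
    ∫⁻ x, ker q x * tailArea μ q.2 x ^ δ ≤
      kerMass n ^ (1 - δ) * ((2 : ℕ) ^ (n + 1) * (2 * kerMass n)) ^ δ *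
        tailArea μ q.2 q.1 ^ δ := by
  have hsplit : ∀ x, ker q x * tailArea μ q.2 x ^ δ =
      ker q x ^ (1 - δ) * (ker q x * tailArea μ q.2 x) ^ δ := by
    intro x
    rw [ENNReal.mul_rpow_of_nonneg _ _ h0.le, ← mul_assoc,
      ← ENNReal.rpow_add_of_nonneg _ _ (by linarith) h0.le, sub_add_cancel, ENNReal.rpow_one]
  simp_rw [hsplit]
  refine (ENNReal.lintegral_mul_norm_pow_le (by fun_prop) (by fun_prop) (by linarith) h0.le
    (by ring)).trans ?_
  rw [lintegral_ker hq, mul_assoc, ← ENNReal.mul_rpow_of_nonneg _ _ h0.le]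
  gcongr
  exact lintegral_ker_mul_tailArea_le hq

lemma tailArea_harnack {s : ℝ} (hs : 0 < s) {x x' : Fin n → ℝ} (h : ‖x - x'‖ ≤ 16 * s) :
    tailArea μ s x ≤ (17 : ℕ) ^ (n + 1) * tailArea μ s x' := by
  rw [tailArea, tailArea, ← lintegral_const_mul _ (by fun_prop)]
  refine setLIntegral_mono' (measurableSet_height_ge _) fun q hq => ?_
  have hq : s ≤ q.2 := hq
  exact ker_harnack (hs.trans_le hq) (h.trans (by linarith))

lemma weight_harnack {δ : ℝ} (h1 : δ < 1) {q : (Fin n → ℝ) × ℝ} (hq : 0 < q.2)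
    {x x' : Fin n → ℝ} (h : ‖x - x'‖ ≤ 16 * q.2) :
    ker q x * tailArea μ q.2 x ^ (δ - 1) ≤
      ((17 : ℕ) ^ (n + 1) * ((17 : ℕ) ^ (n + 1)) ^ (1 - δ)) *
        (ker q x' * tailArea μ q.2 x' ^ (δ - 1)) := by
  set c : ℝ≥0∞ := (17 : ℕ) ^ (n + 1) with hc
  have hc0 : c ≠ 0 := by simp [hc]
  have hct : c ≠ ⊤ := by rw [hc]; finiteness
  have h2 : tailArea μ q.2 x ^ (δ - 1) ≤ c ^ (1 - δ) * tailArea μ q.2 x' ^ (δ - 1) := by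
    have h3 : c⁻¹ * tailArea μ q.2 x' ≤ tailArea μ q.2 x := by
      rw [ENNReal.inv_mul_le_iff hc0 hct]
      exact tailArea_harnack hq (by rwa [norm_sub_rev])
    refine (rpow_antitone_of_nonpos (by linarith) h3).trans_eq ?_
    have hinv : (c⁻¹ : ℝ≥0∞) ^ (δ - 1) = c ^ (1 - δ) := by
      rw [ENNReal.inv_rpow, ← ENNReal.rpow_neg, neg_sub]
    rcases eq_or_ne (tailArea μ q.2 x') 0 with hz | hz
    · rw [hz, mul_zero, ENNReal.zero_rpow_of_neg (by linarith), ENNReal.mul_top]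
      exact (ENNReal.rpow_pos (pos_iff_ne_zero.2 hc0) hct).ne'
    · rw [ENNReal.mul_rpow_of_ne_zero (ENNReal.inv_ne_zero.2 hct) hz, hinv]
  calc ker q x * tailArea μ q.2 x ^ (δ - 1)
      ≤ (c * ker q x') * (c ^ (1 - δ) * tailArea μ q.2 x' ^ (δ - 1)) := by
        gcongr; exact ker_harnack hq h
    _ = _ := by ring

/-- `μ` obeys a Carleson-type condition with density `f`. -/
def CarlesonBound (μ : Measure ((Fin n → ℝ) × ℝ)) (f : (Fin n → ℝ) → ℝ≥0∞) (K : ℝ≥0∞) : Prop :=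
  ∀ (c : Fin n → ℝ) (s : ℝ), 0 < s →
    μ (Metric.ball c s ×ˢ Ioc 0 s) ≤ K * ∫⁻ x in Metric.ball c (16 * s), f x

/-- The characteristic function of `{dist x y < r}`. -/
def near (r : ℝ) (x y : Fin n → ℝ) : ℝ≥0∞ :=
  {p : (Fin n → ℝ) × (Fin n → ℝ) | dist p.1 p.2 < r}.indicator 1 (x, y)

@[fun_prop]
lemma measurable_near_comp {β : Type*} [MeasurableSpace β] (r : ℝ) {f g : β → Fin n → ℝ}
    (hf : Measurable f) (hg : Measurable g) : Measurable fun b => near r (f b) (g b) := by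
  have h : MeasurableSet {p : (Fin n → ℝ) × (Fin n → ℝ) | dist p.1 p.2 < r} :=
    measurableSet_lt (by fun_prop) (by fun_prop)
  exact (measurable_one.indicator h).comp (hf.prodMk hg)

lemma near_comm (r : ℝ) (x y : Fin n → ℝ) : near r x y = near r y x := by
  simp [near, indicator_apply, dist_comm]

lemma lintegral_near_mul (r : ℝ) (y : Fin n → ℝ) (g : (Fin n → ℝ) → ℝ≥0∞) :
    ∫⁻ x, near r x y * g x = ∫⁻ x in Metric.ball y r, g x := by
  rw [← lintegral_indicator Metric.isOpen_ball.measurableSet]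
  congr 1; ext x
  by_cases h : dist x y < r <;> simp [near, h]

lemma CarlesonBound.lintegral_le [SFinite μ] {f W : (Fin n → ℝ) → ℝ≥0∞} {K H : ℝ≥0∞} {s : ℝ}
    (hμ : CarlesonBound μ f K) (hf : Measurable f) (hW : Measurable W) (hs : 0 < s)
    (hH : ∀ x x', ‖x - x'‖ ≤ 16 * s → W x ≤ H * W x') :
    ∫⁻ q in {q | 0 < q.2 ∧ q.2 ≤ s}, W q.1 ∂μ ≤ (H * H * K * 16 ^ n) * ∫⁻ x, f x * W x := by
  set v : ℝ≥0∞ := ENNReal.ofReal ((2 * s) ^ n) with hv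
  have hv0 : v ≠ 0 := by rw [hv]; simp; positivity
  have hvt : v ≠ ⊤ := ENNReal.ofReal_ne_top
  have hvol : ∀ y : Fin n → ℝ, volume (Metric.ball y s) = v := fun y => by
    rw [Real.volume_pi_ball _ hs, Fintype.card_fin]
  have hvol' : ∀ y : Fin n → ℝ, volume (Metric.ball y (16 * s)) = 16 ^ n * v := fun y => by
    rw [Real.volume_pi_ball _ (by positivity), Fintype.card_fin, hv,
      show 2 * (16 * s) = 16 * (2 * s) by ring, mul_pow, ENNReal.ofReal_mul (by positivity),
      ENNReal.ofReal_pow (by norm_num)]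
    norm_num
  set A : Set ((Fin n → ℝ) × ℝ) := {q | 0 < q.2 ∧ q.2 ≤ s} with hA
  have hAm : MeasurableSet A :=
    (measurableSet_lt measurable_const measurable_snd).inter
      (measurableSet_le measurable_snd measurable_const)
  have hlow : ∀ y, v * W y ≤ H * ∫⁻ x, near s x y * W x := by
    intro y
    rw [lintegral_near_mul, ← lintegral_const_mul _ hW, ← hvol y, mul_comm, ← setLIntegral_const]
    refine setLIntegral_mono' Metric.isOpen_ball.measurableSet fun x hx => hH _ _ ?_
    rw [← dist_eq_norm, dist_comm]
    have : dist x y < s := hx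
    linarith
  have hhigh : ∀ y, ∫⁻ x, near (16 * s) x y * W x ≤ H * (16 ^ n * v) * W y := by
    intro y
    rw [lintegral_near_mul, ← hvol' y, show H * volume (Metric.ball y (16 * s)) * W y =
      H * W y * volume (Metric.ball y (16 * s)) by ring, ← setLIntegral_const]
    refine setLIntegral_mono' Metric.isOpen_ball.measurableSet fun x hx => hH _ _ ?_
    rw [← dist_eq_norm]
    exact (show dist x y < 16 * s from hx).le
  have hbox : ∀ x, ∫⁻ q in A, near s x q.1 ∂μ ≤ K * ∫⁻ w, near (16 * s) w x * f w := by
    intro x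
    rw [lintegral_near_mul]
    refine le_trans (le_of_eq ?_) (hμ x s hs)
    have hB : MeasurableSet {q : (Fin n → ℝ) × ℝ | dist x q.1 < s} :=
      measurableSet_lt (by fun_prop) (by fun_prop)
    have : ∀ q : (Fin n → ℝ) × ℝ, near s x q.1 =
        {q : (Fin n → ℝ) × ℝ | dist x q.1 < s}.indicator 1 q := fun q => rfl
    simp_rw [this]
    rw [lintegral_indicator_one hB, Measure.restrict_apply hB]
    congr 1; ext q
    simp [hA, dist_comm x]
  have key : v * ∫⁻ q in A, W q.1 ∂μ ≤ v * ((H * H * K * 16 ^ n) * ∫⁻ x, f x * W x) := by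
    calc v * ∫⁻ q in A, W q.1 ∂μ = ∫⁻ q in A, v * W q.1 ∂μ :=
          (lintegral_const_mul _ (by fun_prop)).symm
      _ ≤ ∫⁻ q in A, (H * ∫⁻ x, near s x q.1 * W x) ∂μ := lintegral_mono fun q => hlow q.1
      _ = H * ∫⁻ q in A, (∫⁻ x, near s x q.1 * W x) ∂μ :=
          lintegral_const_mul _ (Measurable.lintegral_prod_right'
            (f := fun z : ((Fin n → ℝ) × ℝ) × (Fin n → ℝ) => near s z.2 z.1.1 * W z.2)
            (by fun_prop))
      _ = H * ∫⁻ x, ∫⁻ q in A, near s x q.1 * W x ∂μ := by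
          rw [lintegral_lintegral_swap (by unfold Function.uncurry; fun_prop)]
      _ = H * ∫⁻ x, (∫⁻ q in A, near s x q.1 ∂μ) * W x := by
          congr 2; ext x
          rw [lintegral_mul_const _ (by fun_prop)]
      _ ≤ H * ∫⁻ x, (K * ∫⁻ w, near (16 * s) w x * f w) * W x := by
          gcongr with x; exact hbox x
      _ = H * ∫⁻ x, ∫⁻ w, K * (near (16 * s) x w * W x * f w) := by
          congr 2; ext x
          rw [lintegral_const_mul _ (by fun_prop), mul_assoc, ← lintegral_mul_const _ (by fun_prop)]
          congr 2; ext w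
          rw [near_comm]; ring
      _ = H * ∫⁻ w, ∫⁻ x, K * (near (16 * s) x w * W x * f w) := by
          rw [lintegral_lintegral_swap (by unfold Function.uncurry; fun_prop)]
      _ = H * ∫⁻ w, K * ((∫⁻ x, near (16 * s) x w * W x) * f w) := by
          congr 2; ext w
          rw [lintegral_const_mul _ (by fun_prop), lintegral_mul_const _ (by fun_prop)]
      _ ≤ H * ∫⁻ w, K * ((H * (16 ^ n * v) * W w) * f w) := by
          gcongr with w; exact hhigh w
      _ = H * ∫⁻ w, (K * H * 16 ^ n * v) * (f w * W w) := by
          congr 2; ext w; ring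
      _ = v * ((H * H * K * 16 ^ n) * ∫⁻ x, f x * W x) := by
          rw [lintegral_const_mul _ (by fun_prop)]; ring
  exact (ENNReal.mul_le_mul_iff_right hv0 hvt).1 key

/-- The constant in `CarlesonBound.lintegral_area_rpow_le_mul`. -/
def areaConst (n : ℕ) (δ : ℝ) (K : ℝ≥0∞) : ℝ≥0∞ :=
  2 * (kerMass n ^ (1 - δ) * ((2 : ℕ) ^ (n + 1) * (2 * kerMass n)) ^ δ) *
    (((17 : ℕ) ^ (n + 1) * ((17 : ℕ) ^ (n + 1)) ^ (1 - δ)) *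
      ((17 : ℕ) ^ (n + 1) * ((17 : ℕ) ^ (n + 1)) ^ (1 - δ)) * K * 16 ^ n) * tailConst δ

lemma areaConst_ne_top {δ : ℝ} (h0 : 0 < δ) (h1 : δ < 1) {K : ℝ≥0∞} (hK : K ≠ ⊤) :
    areaConst n δ K ≠ ⊤ := by
  have hm := kerMass_ne_top n
  have ht := tailConst_ne_top h0
  have h17 : ((17 : ℕ) ^ (n + 1) : ℝ≥0∞) ^ (1 - δ) ≠ ⊤ :=
    ENNReal.rpow_ne_top_of_nonneg (by linarith) (by finiteness)
  have h2 : kerMass n ^ (1 - δ) ≠ ⊤ := ENNReal.rpow_ne_top_of_nonneg (by linarith) hm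
  have h3 : ((2 : ℕ) ^ (n + 1) * (2 * kerMass n)) ^ δ ≠ ⊤ :=
    ENNReal.rpow_ne_top_of_nonneg h0.le (by finiteness)
  unfold areaConst
  finiteness

lemma CarlesonBound.lintegral_area_rpow_le_mul [SFinite μ] {f : (Fin n → ℝ) → ℝ≥0∞}
    {K : ℝ≥0∞} (hμ : CarlesonBound μ f K) (hf : Measurable f) (hpos : ∀ᵐ q ∂μ, 0 < q.2)
    (hfin : ∀ x, ∫⁻ q, ker q x ∂μ ≠ ⊤) {δ : ℝ} (h0 : 0 < δ) (h1 : δ < 1) :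
    ∫⁻ x, (∫⁻ q, ker q x ∂μ) ^ (1 + δ) ≤
      areaConst n δ K * ∫⁻ x, f x * (∫⁻ q, ker q x ∂μ) ^ δ := by
  set c₁ : ℝ≥0∞ := kerMass n ^ (1 - δ) * ((2 : ℕ) ^ (n + 1) * (2 * kerMass n)) ^ δ with hc₁
  set H : ℝ≥0∞ := (17 : ℕ) ^ (n + 1) * ((17 : ℕ) ^ (n + 1)) ^ (1 - δ) with hH
  set w : (Fin n → ℝ) × ℝ → (Fin n → ℝ) → ℝ≥0∞ :=
    fun q x => ker q x * tailArea μ q.2 x ^ (δ - 1) with hw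
  have hwm : Measurable fun z : ((Fin n → ℝ) × ℝ) × (Fin n → ℝ) => w z.1 z.2 := by
    rw [hw]; fun_prop
  have hwm' : ∀ q, Measurable (w q) := fun q => by rw [hw]; fun_prop
  have hSm := measurable_area (μ := μ)
  set A : Set (((Fin n → ℝ) × ℝ) × ((Fin n → ℝ) × ℝ)) := {z | z.1.2 ≤ z.2.2} with hA
  have hAm : MeasurableSet A := measurableSet_le (by fun_prop) (by fun_prop)
  have hinner : ∀ᵐ q' ∂μ, ∫⁻ q, A.indicator (fun z => w z.2 z.1.1) (q, q') ∂μ ≤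
      (H * H * K * 16 ^ n) * ∫⁻ x, f x * w q' x := by
    filter_upwards [hpos] with q' hq'
    refine le_trans (le_of_eq ?_)
      (hμ.lintegral_le hf (hwm' q') hq' fun x x' h => weight_harnack h1 hq' h)
    have hm : MeasurableSet {q : (Fin n → ℝ) × ℝ | 0 < q.2 ∧ q.2 ≤ q'.2} :=
      (measurableSet_lt measurable_const measurable_snd).inter
        (measurableSet_le measurable_snd measurable_const)
    rw [← lintegral_indicator hm]
    refine lintegral_congr_ae (hpos.mono fun q hq => ?_)
    simp [hA, indicator_apply, hq]
  calc ∫⁻ x, (∫⁻ q, ker q x ∂μ) ^ (1 + δ)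
      ≤ ∫⁻ x, 2 * ∫⁻ q, ker q x * tailArea μ q.2 x ^ δ ∂μ :=
        lintegral_mono fun x => area_rpow_le h0 h1 (hfin x)
    _ = 2 * ∫⁻ x, ∫⁻ q, ker q x * tailArea μ q.2 x ^ δ ∂μ :=
        lintegral_const_mul _ (Measurable.lintegral_prod_right'
          (f := fun z : (Fin n → ℝ) × ((Fin n → ℝ) × ℝ) =>
            ker z.2 z.1 * tailArea μ z.2.2 z.1 ^ δ) (by fun_prop))
    _ = 2 * ∫⁻ q, (∫⁻ x, ker q x * tailArea μ q.2 x ^ δ) ∂μ := by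
        rw [lintegral_lintegral_swap (by unfold Function.uncurry; fun_prop)]
    _ ≤ 2 * ∫⁻ q, c₁ * tailArea μ q.2 q.1 ^ δ ∂μ := by
        refine mul_le_mul_right (lintegral_mono_ae (hpos.mono fun q hq => ?_)) _
        exact lintegral_ker_mul_tailArea_rpow_space_le h0 h1 hq
    _ = 2 * c₁ * ∫⁻ q, tailArea μ q.2 q.1 ^ δ ∂μ := by
        rw [lintegral_const_mul _ (by fun_prop), ← mul_assoc]
    _ ≤ 2 * c₁ * ∫⁻ q, ∫⁻ q', A.indicator (fun z => w z.2 z.1.1) (q, q') ∂μ ∂μ := by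
        gcongr with q
        refine (tailArea_rpow_le h0 h1 (hfin q.1) q.2).trans_eq ?_
        rw [← lintegral_indicator (measurableSet_height_ge _)]
        rfl
    _ = 2 * c₁ * ∫⁻ q', ∫⁻ q, A.indicator (fun z => w z.2 z.1.1) (q, q') ∂μ ∂μ := by
        rw [lintegral_lintegral_swap]
        refine (Measurable.indicator ?_ hAm).aemeasurable
        exact hwm.comp (measurable_snd.prodMk (measurable_fst.comp measurable_fst))
    _ ≤ 2 * c₁ * ∫⁻ q', ((H * H * K * 16 ^ n) * ∫⁻ x, f x * w q' x) ∂μ :=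
        mul_le_mul_right (lintegral_mono_ae hinner) _
    _ = 2 * c₁ * (H * H * K * 16 ^ n) * ∫⁻ q', (∫⁻ x, f x * w q' x) ∂μ := by
        rw [lintegral_const_mul, ← mul_assoc]
        exact Measurable.lintegral_prod_right'
          (f := fun z : ((Fin n → ℝ) × ℝ) × (Fin n → ℝ) => f z.2 * w z.1 z.2) (by fun_prop)
    _ = 2 * c₁ * (H * H * K * 16 ^ n) * ∫⁻ x, ∫⁻ q', f x * w q' x ∂μ := by
        rw [lintegral_lintegral_swap (by unfold Function.uncurry; fun_prop)]
    _ ≤ 2 * c₁ * (H * H * K * 16 ^ n) *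
          ∫⁻ x, tailConst δ * (f x * (∫⁻ q, ker q x ∂μ) ^ δ) := by
        gcongr with x
        rw [lintegral_const_mul _ (by rw [hw]; fun_prop), mul_left_comm]
        gcongr
        exact lintegral_ker_mul_tailArea_rpow_le h1 (hfin x)
    _ = areaConst n δ K * ∫⁻ x, f x * (∫⁻ q, ker q x ∂μ) ^ δ := by
        rw [lintegral_const_mul _ (by fun_prop), ← mul_assoc]
        rfl

lemma le_rpow_mul_of_le_mul_rpow {I F C : ℝ≥0∞} {δ : ℝ} (h0 : 0 < δ) (hI : I ≠ ⊤)
    (h : I ≤ C * (F ^ (1 / (1 + δ)) * I ^ (δ / (1 + δ)))) : I ≤ C ^ (1 + δ) * F := by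
  rcases eq_or_ne I 0 with hz | hz
  · rw [hz]; exact zero_le
  have hr : 0 < 1 + δ := by linarith
  have hJ0 : I ^ (δ / (1 + δ)) ≠ 0 := (ENNReal.rpow_pos (pos_iff_ne_zero.2 hz) hI).ne'
  have hJt : I ^ (δ / (1 + δ)) ≠ ⊤ := ENNReal.rpow_ne_top_of_nonneg (by positivity) hI
  have h2 : I ^ (1 / (1 + δ)) ≤ C * F ^ (1 / (1 + δ)) := by
    refine (ENNReal.mul_le_mul_iff_left hJ0 hJt).1 ?_
    rw [← ENNReal.rpow_add _ _ hz hI, ← add_div, div_self hr.ne', ENNReal.rpow_one, mul_assoc]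
    exact h
  have h3 := ENNReal.rpow_le_rpow h2 hr.le
  rwa [ENNReal.mul_rpow_of_nonneg _ _ hr.le, ← ENNReal.rpow_mul, ← ENNReal.rpow_mul,
    one_div_mul_cancel hr.ne', ENNReal.rpow_one, ENNReal.rpow_one] at h3

theorem CarlesonBound.lintegral_area_rpow_le [IsFiniteMeasure μ] {f : (Fin n → ℝ) → ℝ≥0∞}
    {K : ℝ≥0∞} (hμ : CarlesonBound μ f K) (hf : Measurable f) {t : ℝ} (ht : 0 < t)
    (hpos : ∀ᵐ q ∂μ, t ≤ q.2) {δ : ℝ} (h0 : 0 < δ) (h1 : δ < 1) :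
    ∫⁻ x, (∫⁻ q, ker q x ∂μ) ^ (1 + δ) ≤
      areaConst n δ K ^ (1 + δ) * ∫⁻ x, f x ^ (1 + δ) := by
  have hSm := measurable_area (μ := μ)
  have hpos' : ∀ᵐ q ∂μ, 0 < q.2 := hpos.mono fun q hq => ht.trans_le hq
  set B : ℝ≥0∞ := ENNReal.ofReal ((t ^ n)⁻¹) * μ univ with hB
  have hBt : B ≠ ⊤ := by rw [hB]; finiteness
  have hbound : ∀ x, ∫⁻ q, ker q x ∂μ ≤ B := fun x => by
    rw [hB, ← lintegral_const]
    exact lintegral_mono_ae (hpos.mono fun q hq => ker_le_of_le ht hq x)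
  have hfin : ∀ x, ∫⁻ q, ker q x ∂μ ≠ ⊤ := fun x => ((hbound x).trans_lt hBt.lt_top).ne
  have hL1 : ∫⁻ x, ∫⁻ q, ker q x ∂μ ≠ ⊤ := by
    rw [lintegral_lintegral_swap (by unfold Function.uncurry; fun_prop),
      lintegral_congr_ae (hpos'.mono fun q hq => lintegral_ker hq), lintegral_const]
    exact ENNReal.mul_ne_top (kerMass_ne_top n) (measure_ne_top _ _)
  have hIfin : ∫⁻ x, (∫⁻ q, ker q x ∂μ) ^ (1 + δ) ≠ ⊤ := by
    refine ne_top_of_le_ne_top (ENNReal.mul_ne_top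
      (ENNReal.rpow_ne_top_of_nonneg h0.le hBt) hL1) ?_
    rw [← lintegral_const_mul _ hSm]
    refine lintegral_mono fun x => ?_
    rw [ENNReal.rpow_add_of_nonneg _ _ zero_le_one h0.le, ENNReal.rpow_one, mul_comm]
    gcongr
    exact hbound x
  refine le_rpow_mul_of_le_mul_rpow h0 hIfin
    ((hμ.lintegral_area_rpow_le_mul hf hpos' hfin h0 h1).trans ?_)
  gcongr
  have hr : (1 + δ) ≠ 0 := by positivity
  have hsplit : ∀ x, f x * (∫⁻ q, ker q x ∂μ) ^ δ =
      (f x ^ (1 + δ)) ^ (1 / (1 + δ)) * ((∫⁻ q, ker q x ∂μ) ^ (1 + δ)) ^ (δ / (1 + δ)) := by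
    intro x
    rw [← ENNReal.rpow_mul, ← ENNReal.rpow_mul, mul_one_div_cancel hr, mul_div_cancel₀ _ hr,
      ENNReal.rpow_one]
  simp_rw [hsplit]
  exact ENNReal.lintegral_mul_norm_pow_le (by fun_prop) (by fun_prop) (by positivity)
    (by positivity) (by field_simp)

lemma CarlesonBound.measure_univ_le {f : (Fin n → ℝ) → ℝ≥0∞} {K : ℝ≥0∞}
    (hμ : CarlesonBound μ f K) (hpos : ∀ᵐ q ∂μ, 0 < q.2) : μ univ ≤ K * ∫⁻ x, f x := by
  set T : ℕ → Set ((Fin n → ℝ) × ℝ) := fun k => Metric.ball 0 (k + 1) ×ˢ Ioc 0 ((k : ℝ) + 1)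
    with hT
  have hmono : Monotone T := by
    intro j k hjk
    have : (j : ℝ) ≤ k := by exact_mod_cast hjk
    exact prod_mono (Metric.ball_subset_ball (by linarith)) (Ioc_subset_Ioc le_rfl (by linarith))
  have hcover : {q : (Fin n → ℝ) × ℝ | 0 < q.2} ⊆ ⋃ k, T k := by
    intro q hq
    obtain ⟨k, hk⟩ := exists_nat_gt (max ‖q.1‖ q.2)
    refine mem_iUnion.2 ⟨k, ?_, hq, ?_⟩
    · have := (le_max_left ‖q.1‖ q.2).trans_lt hk
      simp only [Metric.mem_ball, dist_zero_right]
      linarith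
    · have := (le_max_right ‖q.1‖ q.2).trans_lt hk
      linarith
  calc μ univ = μ {q | 0 < q.2} := by
        exact (measure_congr (Filter.eventuallyEq_univ.2 hpos)).symm
    _ ≤ μ (⋃ k, T k) := measure_mono hcover
    _ = ⨆ k, μ (T k) := hmono.measure_iUnion
    _ ≤ K * ∫⁻ x, f x := iSup_le fun k => (hμ 0 (k + 1) (by positivity)).trans
        (mul_le_mul_right (setLIntegral_le_lintegral _ _) _)

lemma CarlesonBound.mono_measure {μ' : Measure ((Fin n → ℝ) × ℝ)} {f : (Fin n → ℝ) → ℝ≥0∞}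
    {K : ℝ≥0∞} (hμ : CarlesonBound μ f K) (h : μ' ≤ μ) : CarlesonBound μ' f K :=
  fun c s hs => (h _).trans (hμ c s hs)

lemma monotone_setOf_one_div_le_height :
    Monotone fun k : ℕ => {q : (Fin n → ℝ) × ℝ | 1 / ((k : ℝ) + 1) ≤ q.2} := by
  intro j k hjk q hq
  have h : 1 / ((k : ℝ) + 1) ≤ 1 / ((j : ℝ) + 1) :=
    one_div_le_one_div_of_le (by positivity) (by
      have : (j : ℝ) ≤ k := by exact_mod_cast hjk
      linarith)
  exact h.trans (show 1 / ((j : ℝ) + 1) ≤ q.2 from hq)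

lemma area_eq_iSup (hpos : ∀ᵐ q ∂μ, 0 < q.2) (x : Fin n → ℝ) :
    ∫⁻ q, ker q x ∂μ = ⨆ k : ℕ, ∫⁻ q in {q | 1 / ((k : ℝ) + 1) ≤ q.2}, ker q x ∂μ := by
  have hU : (⋃ k : ℕ, {q : (Fin n → ℝ) × ℝ | 1 / ((k : ℝ) + 1) ≤ q.2}) = {q | 0 < q.2} := by
    ext q
    simp only [mem_iUnion, Set.mem_ofPred_eq]
    refine ⟨fun ⟨k, hk⟩ => lt_of_lt_of_le (by positivity) hk, fun hq => ?_⟩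
    obtain ⟨k, hk⟩ := exists_nat_one_div_lt hq
    exact ⟨k, hk.le⟩
  rw [← setLIntegral_iUnion_of_directed _ monotone_setOf_one_div_le_height.directed_le, hU,
    Measure.restrict_eq_self_of_ae_mem (s := {q : (Fin n → ℝ) × ℝ | 0 < q.2}) hpos]

/-- The constant in `CarlesonBound.lintegral_area_rpow_le_of_pos`. -/
def tentConst (n : ℕ) (δ : ℝ) (K : ℝ≥0∞) : ℝ≥0∞ :=
  if δ = 0 then kerMass n * K else areaConst n δ K ^ (1 + δ)

lemma tentConst_ne_top {δ : ℝ} (h0 : 0 ≤ δ) (h1 : δ < 1) {K : ℝ≥0∞} (hK : K ≠ ⊤) :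
    tentConst n δ K ≠ ⊤ := by
  unfold tentConst
  split_ifs with h
  · exact ENNReal.mul_ne_top (kerMass_ne_top n) hK
  · exact ENNReal.rpow_ne_top_of_nonneg (by linarith)
      (areaConst_ne_top (lt_of_le_of_ne h0 (Ne.symm h)) h1 hK)

theorem CarlesonBound.lintegral_area_rpow_le_of_pos [IsFiniteMeasure μ]
    {f : (Fin n → ℝ) → ℝ≥0∞} {K : ℝ≥0∞} (hμ : CarlesonBound μ f K) (hf : Measurable f)
    (hpos : ∀ᵐ q ∂μ, 0 < q.2) {δ : ℝ} (h0 : 0 ≤ δ) (h1 : δ < 1) :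
    ∫⁻ x, (∫⁻ q, ker q x ∂μ) ^ (1 + δ) ≤ tentConst n δ K * ∫⁻ x, f x ^ (1 + δ) := by
  rcases h0.eq_or_lt with rfl | h0
  · simp only [add_zero, ENNReal.rpow_one, tentConst, if_true]
    rw [lintegral_lintegral_swap (by unfold Function.uncurry; fun_prop),
      lintegral_congr_ae (hpos.mono fun q hq => lintegral_ker hq), lintegral_const, mul_assoc]
    exact mul_le_mul_right (hμ.measure_univ_le hpos) _
  rw [tentConst, if_neg h0.ne']
  have hr : 0 < 1 + δ := by linarith
  have hsup : ∀ x, (∫⁻ q, ker q x ∂μ) ^ (1 + δ) =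
      ⨆ k : ℕ, (∫⁻ q in {q | 1 / ((k : ℝ) + 1) ≤ q.2}, ker q x ∂μ) ^ (1 + δ) := by
    intro x
    rw [area_eq_iSup hpos]
    exact (ENNReal.orderIsoRpow (1 + δ) hr).map_iSup _
  simp_rw [hsup]
  rw [lintegral_iSup]
  · refine iSup_le fun k => ?_
    refine (hμ.mono_measure Measure.restrict_le_self).lintegral_area_rpow_le hf
      (t := 1 / ((k : ℝ) + 1)) (by positivity) ?_ h0 h1
    exact ae_restrict_mem (measurableSet_height_ge _)
  · intro k
    exact measurable_area.pow_const _
  · intro j k hjk x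
    exact ENNReal.rpow_le_rpow
      (lintegral_mono_set (monotone_setOf_one_div_le_height hjk)) hr.le

end Tent

section Lusin

variable {n : ℕ} {G : (Fin n → ℝ) × ℝ → ℝ≥0∞}

/-- The measure `G(y,t) t dy dt` on the upper half space. -/
def energyMeasure (G : (Fin n → ℝ) × ℝ → ℝ≥0∞) : Measure ((Fin n → ℝ) × ℝ) :=
  (volume.restrict {q | 0 < q.2}).withDensity fun q => G q * ENNReal.ofReal q.2

lemma measurableSet_height_pos : MeasurableSet {q : (Fin n → ℝ) × ℝ | 0 < q.2} :=
  measurableSet_lt measurable_const measurable_snd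

lemma energyMeasure_ae_pos : ∀ᵐ q ∂energyMeasure G, 0 < q.2 :=
  (withDensity_absolutelyContinuous _ _).ae_le (ae_restrict_mem measurableSet_height_pos)

lemma lintegral_energyMeasure (hG : Measurable G) {g : (Fin n → ℝ) × ℝ → ℝ≥0∞}
    (hg : Measurable g) :
    ∫⁻ q, g q ∂energyMeasure G = ∫⁻ q in {q | 0 < q.2}, G q * ENNReal.ofReal q.2 * g q := by
  rw [energyMeasure, lintegral_withDensity_eq_lintegral_mul _ (by fun_prop) hg]
  rfl

lemma measurable_eudist : Measurable fun z : (Fin n → ℝ) × (Fin n → ℝ) => eudist z.1 z.2 := by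
  unfold eudist; fun_prop

lemma norm_sub_le_eudist (x y : Fin n → ℝ) : ‖x - y‖ ≤ eudist x y := by
  refine (pi_norm_le_iff_of_nonneg (Real.sqrt_nonneg _)).2 fun i => ?_
  rw [Real.norm_eq_abs]
  refine Real.abs_le_sqrt ?_
  exact Finset.single_le_sum (f := fun i => (x i - y i) ^ 2) (fun i _ => sq_nonneg _)
    (Finset.mem_univ i)

lemma eudist_lt_of_norm_sub_lt (hn : 1 ≤ n) {x y : Fin n → ℝ} {t : ℝ} (h : ‖x - y‖ < t / n) :
    eudist x y < t := by
  have hn' : (1 : ℝ) ≤ n := by exact_mod_cast hn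
  have ht : 0 < t := by
    have := (norm_nonneg _).trans_lt h
    by_contra hneg
    exact absurd this (not_lt.2 (div_nonpos_of_nonpos_of_nonneg (not_lt.1 hneg) (by positivity)))
  have h1 : ∑ i, (x i - y i) ^ 2 ≤ n * ‖x - y‖ ^ 2 := by
    calc ∑ i, (x i - y i) ^ 2 ≤ ∑ _i : Fin n, ‖x - y‖ ^ 2 := by
          refine Finset.sum_le_sum fun i _ => ?_
          rw [← sq_abs]
          gcongr
          exact norm_le_pi_norm (x - y) i
      _ = n * ‖x - y‖ ^ 2 := by simp
  rw [lt_div_iff₀ (by positivity)] at h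
  refine (Real.sqrt_lt' ht).2 (h1.trans_lt ?_)
  calc (n : ℝ) * ‖x - y‖ ^ 2 ≤ (‖x - y‖ * n) ^ 2 := by
        nlinarith [sq_nonneg ‖x - y‖, mul_nonneg (sq_nonneg ‖x - y‖)
          (mul_nonneg (sub_nonneg.2 hn') (zero_le_one.trans hn'))]
    _ < t ^ 2 := by gcongr

/-- The cone `{0 < t, |x - y| < t}` with vertex `x`. -/
def cone (x : Fin n → ℝ) : Set ((Fin n → ℝ) × ℝ) := {q | 0 < q.2 ∧ eudist x q.1 < q.2}

lemma measurableSet_cone_uncurry :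
    MeasurableSet {z : (Fin n → ℝ) × ((Fin n → ℝ) × ℝ) | z.2 ∈ cone z.1} := by
  have h1 : MeasurableSet {z : (Fin n → ℝ) × ((Fin n → ℝ) × ℝ) | 0 < z.2.2} :=
    measurableSet_lt measurable_const (by fun_prop)
  have h2 : MeasurableSet {z : (Fin n → ℝ) × ((Fin n → ℝ) × ℝ) | eudist z.1 z.2.1 < z.2.2} :=
    measurableSet_lt (measurable_eudist.comp (by fun_prop :
      Measurable fun z : (Fin n → ℝ) × ((Fin n → ℝ) × ℝ) => (z.1, z.2.1))) (by fun_prop)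
  exact h1.inter h2

lemma measurableSet_cone (x : Fin n → ℝ) : MeasurableSet (cone x) :=
  measurable_prodMk_left (x := x) measurableSet_cone_uncurry

lemma lusin_sq (G : (Fin n → ℝ) × ℝ → ℝ≥0∞) (x : Fin n → ℝ) :
    lusin G x ^ 2 = ∫⁻ q in cone x, G q * ENNReal.ofReal (q.2 ^ ((1 : ℝ) - n)) := by
  rw [lusin, ← ENNReal.rpow_natCast, ← ENNReal.rpow_mul]
  norm_num
  rfl

lemma ofReal_rpow_one_sub {t : ℝ} (ht : 0 < t) :
    ENNReal.ofReal (t ^ ((1 : ℝ) - n)) = ENNReal.ofReal t * ENNReal.ofReal ((t ^ n)⁻¹) := by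
  rw [← ENNReal.ofReal_mul ht.le, Real.rpow_sub ht, Real.rpow_one, Real.rpow_natCast,
    div_eq_mul_inv]

lemma lusin_sq_le (hG : Measurable G) (x : Fin n → ℝ) :
    lusin G x ^ 2 ≤ (2 : ℕ) ^ (n + 1) * ∫⁻ q, ker q x ∂energyMeasure G := by
  rw [lusin_sq, lintegral_energyMeasure hG (by fun_prop), ← lintegral_const_mul _ (by fun_prop)]
  refine (setLIntegral_mono' (measurableSet_cone x) fun q hq => ?_).trans
    (lintegral_mono_set fun q hq => hq.1)
  rw [ofReal_rpow_one_sub hq.1]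
  calc G q * (ENNReal.ofReal q.2 * ENNReal.ofReal ((q.2 ^ n)⁻¹))
      ≤ G q * (ENNReal.ofReal q.2 * ((2 : ℕ) ^ (n + 1) * ker q x)) := by
        gcongr
        exact le_ker_of_norm_le hq.1 ((norm_sub_le_eudist _ _).trans hq.2.le)
    _ = _ := by ring

lemma energyMeasure_univ_le (hn : 1 ≤ n) (hG : Measurable G) :
    ENNReal.ofReal ((2 / n) ^ n) * energyMeasure G univ ≤ ∫⁻ x, lusin G x ^ 2 := by
  have hn' : (0 : ℝ) < n := by exact_mod_cast hn
  set A : Set ((Fin n → ℝ) × ((Fin n → ℝ) × ℝ)) := {z | z.2 ∈ cone z.1} with hA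
  set g : (Fin n → ℝ) × ((Fin n → ℝ) × ℝ) → ℝ≥0∞ :=
    A.indicator fun z => G z.2 * ENNReal.ofReal (z.2.2 ^ ((1 : ℝ) - n)) with hg
  have hgm : Measurable g := Measurable.indicator (by fun_prop) measurableSet_cone_uncurry
  have h1 : ∀ x, lusin G x ^ 2 = ∫⁻ q, g (x, q) := fun x => by
    rw [lusin_sq, ← lintegral_indicator (measurableSet_cone x)]
    rfl
  simp_rw [h1]
  rw [lintegral_lintegral_swap (f := fun x q => g (x, q)) hgm.aemeasurable, energyMeasure,
    withDensity_apply _ MeasurableSet.univ, Measure.restrict_univ,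
    ← lintegral_const_mul _ (by fun_prop)]
  refine (setLIntegral_mono' measurableSet_height_pos fun q hq => ?_).trans
    (setLIntegral_le_lintegral _ _)
  have hq : 0 < q.2 := hq
  have hball : Metric.ball q.1 (q.2 / n) ⊆ {x | (x, q) ∈ A} := fun x hx =>
    ⟨hq, eudist_lt_of_norm_sub_lt hn (by rwa [← dist_eq_norm])⟩
  calc ENNReal.ofReal ((2 / n) ^ n) * (G q * ENNReal.ofReal q.2)
      = (G q * ENNReal.ofReal (q.2 ^ ((1 : ℝ) - n))) * volume (Metric.ball q.1 (q.2 / n)) := by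
        rw [Real.volume_pi_ball _ (by positivity), Fintype.card_fin, ofReal_rpow_one_sub hq,
          show 2 * (q.2 / n) = q.2 * (2 / n) by ring, mul_pow,
          ENNReal.ofReal_mul (by positivity)]
        have : ENNReal.ofReal ((q.2 ^ n)⁻¹) * ENNReal.ofReal (q.2 ^ n) = 1 := by
          rw [← ENNReal.ofReal_mul (by positivity), inv_mul_cancel₀ (by positivity),
            ENNReal.ofReal_one]
        calc ENNReal.ofReal ((2 / n) ^ n) * (G q * ENNReal.ofReal q.2)
            = ENNReal.ofReal ((2 / n) ^ n) * (G q * ENNReal.ofReal q.2) *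
              (ENNReal.ofReal ((q.2 ^ n)⁻¹) * ENNReal.ofReal (q.2 ^ n)) := by
              rw [this, mul_one]
          _ = _ := by ring
    _ ≤ (G q * ENNReal.ofReal (q.2 ^ ((1 : ℝ) - n))) * volume {x | (x, q) ∈ A} := by
        gcongr
    _ = ∫⁻ x, g (x, q) := by
        have hAq : MeasurableSet {x | (x, q) ∈ A} :=
          measurable_prodMk_right (y := q) measurableSet_cone_uncurry
        rw [← setLIntegral_const, ← lintegral_indicator hAq]
        rfl

lemma ball_eq_cube (c : Fin n → ℝ) {s : ℝ} (hs : 0 < s) : Metric.ball c s = cube c (2 * s) := by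
  ext x
  rw [Metric.mem_ball, dist_pi_lt_iff hs]
  simp [cube, Real.dist_eq]

/-- The Carleson constant produced by `carlesonBound_energyMeasure`. -/
def approxConst (n : ℕ) : ℝ≥0∞ := 2 * (ENNReal.ofReal ((2 / n) ^ n))⁻¹ + 2

lemma approxConst_ne_top (hn : 1 ≤ n) : approxConst n ≠ ⊤ := by
  have hn' : (0 : ℝ) < n := by exact_mod_cast hn
  have : (ENNReal.ofReal ((2 / (n : ℝ)) ^ n))⁻¹ ≠ ⊤ := by
    rw [ENNReal.inv_ne_top]; simp; positivity
  unfold approxConst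
  finiteness

lemma sum_nnnorm_sq_le {N : ℕ} (a b : Fin N → ℂ) :
    ∑ j, (‖a j‖₊ : ℝ≥0∞) ^ 2 ≤
      2 * ∑ j, (‖b j‖₊ : ℝ≥0∞) ^ 2 + 2 * ∑ j, (‖a j - b j‖₊ : ℝ≥0∞) ^ 2 := by
  rw [Finset.mul_sum, Finset.mul_sum, ← Finset.sum_add_distrib]
  refine Finset.sum_le_sum fun j _ => ?_
  have h : ‖a j‖ ^ 2 ≤ 2 * ‖b j‖ ^ 2 + 2 * ‖a j - b j‖ ^ 2 := by
    have h1 : ‖a j‖ ≤ ‖b j‖ + ‖a j - b j‖ := by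
      simpa using norm_add_le (b j) (a j - b j)
    nlinarith [norm_nonneg (a j), sq_nonneg (‖b j‖ - ‖a j - b j‖)]
  exact_mod_cast (show ‖a j‖₊ ^ 2 ≤ 2 * ‖b j‖₊ ^ 2 + 2 * ‖a j - b j‖₊ ^ 2 from h)

/-- Local approximability of `u` in energy yields a Carleson condition for its energy measure. -/
lemma carlesonBound_energyMeasure (hn : 1 ≤ n) {N : ℕ} {u : (Fin n → ℝ) × ℝ → Fin N → ℂ}
    (hu : Measurable u) {f : (Fin n → ℝ) → ℝ≥0∞}
    (h : ∀ (c : Fin n → ℝ) (ℓ : ℝ), 0 < ℓ →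
      ∃ uQ : (Fin n → ℝ) × ℝ → Fin N → ℂ, Measurable uQ ∧
        (∫⁻ x, (lusin (fun q => ∑ j, (‖uQ q j‖₊ : ℝ≥0∞) ^ 2) x) ^ 2) +
          (∫⁻ q in (cube c (3 / 2 * ℓ)) ×ˢ Ioo (0 : ℝ) (ℓ / 4),
            (∑ j, (‖u q j - uQ q j‖₊ : ℝ≥0∞) ^ 2) * ENNReal.ofReal q.2) ≤
          ∫⁻ x in cube c (4 * ℓ), f x) :
    CarlesonBound (energyMeasure fun q => ∑ j, (‖u q j‖₊ : ℝ≥0∞) ^ 2) f (approxConst n) := by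
  intro c s hs
  obtain ⟨v, hv, hle⟩ := h c (8 * s) (by positivity)
  have hn' : (0 : ℝ) < n := by exact_mod_cast hn
  set b : ℝ≥0∞ := ENNReal.ofReal ((2 / n) ^ n) with hb
  have hb0 : b ≠ 0 := by rw [hb]; simp; positivity
  have hbt : b ≠ ⊤ := ENNReal.ofReal_ne_top
  rw [ball_eq_cube c (by positivity : 0 < 16 * s),
    show 2 * (16 * s) = 4 * (8 * s) by ring]
  set R := ∫⁻ x in cube c (4 * (8 * s)), f x with hR
  set Gv : (Fin n → ℝ) × ℝ → ℝ≥0∞ := fun q => ∑ j, (‖v q j‖₊ : ℝ≥0∞) ^ 2 with hGv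
  have hGvm : Measurable Gv := by rw [hGv]; fun_prop
  have hT : MeasurableSet (Metric.ball c s ×ˢ Ioc 0 s) :=
    Metric.isOpen_ball.measurableSet.prod measurableSet_Ioc
  have hv1 : energyMeasure Gv univ ≤ b⁻¹ * R := by
    rw [← ENNReal.mul_le_iff_le_inv hb0 hbt]
    exact (energyMeasure_univ_le hn hGvm).trans (le_self_add.trans hle)
  have hv2 : ∫⁻ q in Metric.ball c s ×ˢ Ioc 0 s, Gv q * ENNReal.ofReal q.2 ≤
      energyMeasure Gv univ := by
    rw [energyMeasure, withDensity_apply _ MeasurableSet.univ, Measure.restrict_univ]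
    exact lintegral_mono_set fun q hq => hq.2.1
  have hd : ∫⁻ q in Metric.ball c s ×ˢ Ioc 0 s,
      (∑ j, (‖u q j - v q j‖₊ : ℝ≥0∞) ^ 2) * ENNReal.ofReal q.2 ≤ R := by
    refine (lintegral_mono_set (prod_mono ?_ ?_)).trans (le_add_self.trans hle)
    · rw [show 3 / 2 * (8 * s) = 2 * (6 * s) by ring, ← ball_eq_cube c (by positivity)]
      exact Metric.ball_subset_ball (by linarith)
    · exact fun t ht => ⟨ht.1, by linarith [ht.2]⟩
  rw [energyMeasure, withDensity_apply _ hT, Measure.restrict_restrict hT,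
    show (Metric.ball c s ×ˢ Ioc 0 s) ∩ {q : (Fin n → ℝ) × ℝ | 0 < q.2} =
      Metric.ball c s ×ˢ Ioc 0 s from inter_eq_left.2 fun q hq => hq.2.1]
  calc ∫⁻ q in Metric.ball c s ×ˢ Ioc 0 s,
        (∑ j, (‖u q j‖₊ : ℝ≥0∞) ^ 2) * ENNReal.ofReal q.2
      ≤ ∫⁻ q in Metric.ball c s ×ˢ Ioc 0 s, (2 * (Gv q * ENNReal.ofReal q.2) +
          2 * ((∑ j, (‖u q j - v q j‖₊ : ℝ≥0∞) ^ 2) * ENNReal.ofReal q.2)) := by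
        refine lintegral_mono fun q => ?_
        rw [← mul_assoc, ← mul_assoc, ← add_mul]
        exact mul_le_mul_left (sum_nnnorm_sq_le (u q) (v q)) _
    _ = 2 * (∫⁻ q in Metric.ball c s ×ˢ Ioc 0 s, Gv q * ENNReal.ofReal q.2) +
          2 * ∫⁻ q in Metric.ball c s ×ˢ Ioc 0 s,
            (∑ j, (‖u q j - v q j‖₊ : ℝ≥0∞) ^ 2) * ENNReal.ofReal q.2 := by
        rw [lintegral_add_left (by fun_prop), lintegral_const_mul _ (by fun_prop),
          lintegral_const_mul _ (by fun_prop)]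
    _ ≤ 2 * (b⁻¹ * R) + 2 * R := by
        gcongr
        exact hv2.trans hv1
    _ = approxConst n * R := by rw [approxConst]; ring

lemma lintegral_lusin_rpow_le (hG : Measurable G) {p : ℝ} (hp : 2 ≤ p) :
    ∫⁻ x, lusin G x ^ p ≤ ((2 : ℕ) ^ (n + 1)) ^ (p / 2) *
      ∫⁻ x, (∫⁻ q, ker q x ∂energyMeasure G) ^ (p / 2) := by
  have : SFinite (energyMeasure G) := by unfold energyMeasure; infer_instance
  rw [← lintegral_const_mul _ (measurable_area.pow_const _)]
  refine lintegral_mono fun x => ?_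
  have h : lusin G x ^ p = (lusin G x ^ 2) ^ (p / 2) := by
    rw [← ENNReal.rpow_natCast, ← ENNReal.rpow_mul]
    congr 1; push_cast; ring
  rw [h, ← ENNReal.mul_rpow_of_nonneg _ _ (by linarith)]
  exact ENNReal.rpow_le_rpow (lusin_sq_le hG x) (by linarith)

end Lusin

/-- For each `n ≥ 1` there is `ε > 0` (depending only on `n`) such that:
for `2 ≤ p < 2 + ε` there is `C_p` (depending only on `n, p`) such that for every `N ≥ 1`,
every `u ∈ L²_loc(ℝ^{n+1}_+; ℂ^N)` (with the Euclidean magnitude `|u|² = ∑_j |u_j|²`) with `A₂⁺(tu) ∈ L²(ℝⁿ)`, every nonnegative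
`φ ∈ L²_loc(ℝⁿ)`, if for each cube `Q` there is `u_Q` with
`‖A₂⁺(t u_Q)‖²_{L²} + ∫_{(3/2)Q}∫_0^{ℓ(Q)/4} |u − u_Q|² t dt dx ≤ ‖φ‖²_{L²(4Q)}`,
then `φ ∈ L^p(ℝⁿ)` implies `‖A₂⁺(tu)‖_{L^p} ≤ C_p ‖φ‖_{L^p}`. -/
theorem statement3 (n : ℕ) (hn : 1 ≤ n) :
    ∃ ε : ℝ, 0 < ε ∧
      ∀ p : ℝ, 2 ≤ p → p < 2 + ε →
        ∃ C : ℝ≥0∞, 0 < C ∧ C < ⊤ ∧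
          ∀ (N : ℕ), 1 ≤ N →
          ∀ u : (Fin n → ℝ) × ℝ → Fin N → ℂ, Measurable u →
            L2loc (upperHalf n) (fun q => ∑ j, (‖u q j‖₊ : ℝ≥0∞) ^ 2) →
            (∫⁻ x, (lusin (fun q => ∑ j, (‖u q j‖₊ : ℝ≥0∞) ^ 2) x) ^ 2) < ⊤ →
          ∀ φ : (Fin n → ℝ) → ℝ, Measurable φ → (∀ x, 0 ≤ φ x) →
            (∀ K : Set (Fin n → ℝ), IsCompact K →
              (∫⁻ x in K, ENNReal.ofReal (φ x) ^ 2) < ⊤) →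
            (∀ (c : Fin n → ℝ) (ℓ : ℝ), 0 < ℓ →
              ∃ uQ : (Fin n → ℝ) × ℝ → Fin N → ℂ, Measurable uQ ∧
                L2loc (upperHalf n) (fun q => ∑ j, (‖uQ q j‖₊ : ℝ≥0∞) ^ 2) ∧
                (∫⁻ x, (lusin (fun q => ∑ j, (‖uQ q j‖₊ : ℝ≥0∞) ^ 2) x) ^ 2) +
                  (∫⁻ q in (cube c (3 / 2 * ℓ)) ×ˢ Ioo (0 : ℝ) (ℓ / 4),
                    (∑ j, (‖u q j - uQ q j‖₊ : ℝ≥0∞) ^ 2) * ENNReal.ofReal q.2) ≤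
                  ∫⁻ x in cube c (4 * ℓ), ENNReal.ofReal (φ x) ^ 2) →
            (∫⁻ x, ENNReal.ofReal (φ x) ^ p) < ⊤ →
            (∫⁻ x, (lusin (fun q => ∑ j, (‖u q j‖₊ : ℝ≥0∞) ^ 2) x) ^ p) ^ (1 / p) ≤
              C * (∫⁻ x, ENNReal.ofReal (φ x) ^ p) ^ (1 / p) := by
  refine ⟨2, by norm_num, fun p hp2 hp4 => ?_⟩
  set δ : ℝ := p / 2 - 1 with hδ
  have h0 : 0 ≤ δ := by rw [hδ]; linarith
  have h1 : δ < 1 := by rw [hδ]; linarith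
  have hδp : p / 2 = 1 + δ := by rw [hδ]; ring
  set D : ℝ≥0∞ := ((2 : ℕ) ^ (n + 1)) ^ (p / 2) * tentConst n δ (approxConst n) with hD
  have hDt : D ≠ ⊤ := ENNReal.mul_ne_top
    (ENNReal.rpow_ne_top_of_nonneg (by linarith) (by finiteness))
    (tentConst_ne_top h0 h1 (approxConst_ne_top hn))
  have hDp : D ^ (1 / p) ≠ ⊤ := ENNReal.rpow_ne_top_of_nonneg (by positivity) hDt
  refine ⟨D ^ (1 / p) + 1, by simp, by finiteness, ?_⟩
  intro N _ u hu _ hfin φ hφ _ _ happ _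
  set G : (Fin n → ℝ) × ℝ → ℝ≥0∞ := fun q => ∑ j, (‖u q j‖₊ : ℝ≥0∞) ^ 2 with hG
  have hGm : Measurable G := by rw [hG]; fun_prop
  have hb0 : ENNReal.ofReal ((2 / (n : ℝ)) ^ n) ≠ 0 := by
    have hn' : (0 : ℝ) < n := by exact_mod_cast hn
    simp; positivity
  have : IsFiniteMeasure (energyMeasure G) := by
    refine ⟨?_⟩
    have := (energyMeasure_univ_le hn hGm).trans_lt hfin
    exact ENNReal.lt_top_of_mul_ne_top_right this.ne hb0
  have hcarl : CarlesonBound (energyMeasure G) (fun x => ENNReal.ofReal (φ x) ^ 2)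
      (approxConst n) := by
    refine carlesonBound_energyMeasure hn hu fun c ℓ hℓ => ?_
    obtain ⟨v, hv, -, hle⟩ := happ c ℓ hℓ
    exact ⟨v, hv, hle⟩
  have hmain : ∫⁻ x, lusin G x ^ p ≤ D * ∫⁻ x, ENNReal.ofReal (φ x) ^ p := by
    refine (lintegral_lusin_rpow_le hGm hp2).trans ?_
    rw [hD, mul_assoc]
    refine mul_le_mul_right ?_ _
    have h := hcarl.lintegral_area_rpow_le_of_pos (by fun_prop) energyMeasure_ae_pos h0 h1
    have hpow : ∀ x, (ENNReal.ofReal (φ x) ^ 2) ^ (1 + δ) = ENNReal.ofReal (φ x) ^ p := by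
      intro x
      rw [← ENNReal.rpow_natCast, ← ENNReal.rpow_mul, ← hδp]
      congr 1; push_cast; ring
    simp_rw [hpow] at h
    rwa [hδp]
  calc (∫⁻ x, lusin G x ^ p) ^ (1 / p)
      ≤ (D * ∫⁻ x, ENNReal.ofReal (φ x) ^ p) ^ (1 / p) :=
        ENNReal.rpow_le_rpow hmain (by positivity)
    _ = D ^ (1 / p) * (∫⁻ x, ENNReal.ofReal (φ x) ^ p) ^ (1 / p) :=
        ENNReal.mul_rpow_of_nonneg _ _ (by positivity)
    _ ≤ _ := by gcongr; exact le_self_add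


end
end
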